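/- Let U ⊆ ℂ^m be a connected open set and let Φ : U × conj(U) → ℂ be a nowhere-zero holomorphic Nash function such that Φ(z, conj(z)) is real and positive for every z ∈ U and such that for every z ∈ U the Hermitian matrix g(z) := ( g^Φ_{ij}(z, conj(z)) )_{1 ≤ i, j ≤ m} is positive definite (so that z ↦ log Φ(z, conj(z)) is a Kähler potential with Nash-algebraic exponential polarization). Let D^Φ = det( g^Φ_{ij} ) on U × conj(U), and for z ∈ U define the Ricci matrix Ric(z)_{ij} = −[ (D^Φ)^{-1} · ∂²D^Φ/∂z_i∂w_j − (D^Φ)^{-2} · (∂D^Φ/∂z_i)(∂D^Φ/∂w_j) ] evaluated at (z, conj(z)). Let α, β ∈ ℝ be such that α·Ric(z) + β·g(z) is positive definite for every z ∈ U, and let μ > 0. Let n be a positive integer, V ⊆ ℂ a connected open set, and F = (f₁, …, f_n) : V → ℂ^n, G : V → U holomorphic maps satisfying, for every s ∈ V, Δ_s( Σ_{j=1}^n |f_j(s)|² ) = μ · Δ_s( −α · log( Re D^Φ(G(s), conj(G(s))) ) + β · log( Re Φ(G(s), conj(G(s))) ) ). Then F is constant on V. -/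

import Mathlib

open scoped ComplexOrder

/-- `f` is a Nash function at the point `p₀` of `W ⊆ ℂ^m × ℂ^m`. -/
def IsNashAtPair (m : ℕ) (W : Set ((Fin m → ℂ) × (Fin m → ℂ)))
    (f : (Fin m → ℂ) × (Fin m → ℂ) → ℂ) (p₀ : (Fin m → ℂ) × (Fin m → ℂ)) : Prop :=
  ∃ U : Set ((Fin m → ℂ) × (Fin m → ℂ)), IsOpen U ∧ p₀ ∈ U ∧ U ⊆ W ∧
    ∃ P : MvPolynomial (Option (Fin m ⊕ Fin m)) ℂ, P ≠ 0 ∧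
      ∀ p ∈ U, MvPolynomial.eval (fun o => o.elim (f p) (Sum.elim p.1 p.2)) P = 0

/-- `f` is a Nash function on `W`: holomorphic on `W` and Nash at every point of `W`. -/
def IsNashOnPair (m : ℕ) (W : Set ((Fin m → ℂ) × (Fin m → ℂ)))
    (f : (Fin m → ℂ) × (Fin m → ℂ) → ℂ) : Prop :=
  DifferentiableOn ℂ f W ∧ ∀ p ∈ W, IsNashAtPair m W f p

/-- Partial derivative in the variable `z_i` of a function of `(z, w)`. -/
noncomputable def pderivZ (m : ℕ) (F : (Fin m → ℂ) × (Fin m → ℂ) → ℂ) (i : Fin m) :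
    (Fin m → ℂ) × (Fin m → ℂ) → ℂ :=
  fun p => fderiv ℂ F p (Pi.single i 1, 0)

/-- Partial derivative in the variable `w_j` of a function of `(z, w)`. -/
noncomputable def pderivW (m : ℕ) (F : (Fin m → ℂ) × (Fin m → ℂ) → ℂ) (j : Fin m) :
    (Fin m → ℂ) × (Fin m → ℂ) → ℂ :=
  fun p => fderiv ℂ F p (0, Pi.single j 1)

/-- Entry `(i,j)` of the mixed complex Hessian of `log Φ`:
`g^Φ_{ij} = Φ⁻¹ ∂²Φ/∂z_i∂w_j − Φ⁻² (∂Φ/∂z_i)(∂Φ/∂w_j)`. -/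
noncomputable def gMat (m : ℕ) (Φ : (Fin m → ℂ) × (Fin m → ℂ) → ℂ) (i j : Fin m) :
    (Fin m → ℂ) × (Fin m → ℂ) → ℂ :=
  fun p => (Φ p)⁻¹ * pderivZ m (pderivW m Φ j) i p -
    ((Φ p) ^ 2)⁻¹ * pderivZ m Φ i p * pderivW m Φ j p

/-- `D^Φ = det (g^Φ_{ij})`, the determinant of the mixed complex Hessian of `log Φ`. -/
noncomputable def detG (m : ℕ) (Φ : (Fin m → ℂ) × (Fin m → ℂ) → ℂ) :
    (Fin m → ℂ) × (Fin m → ℂ) → ℂ :=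
  fun p => Matrix.det (Matrix.of fun i j : Fin m => gMat m Φ i j p)

/-- Entry `(i,j)` of the Ricci matrix: `Ric_{ij} = −g^{D^Φ}_{ij}`. -/
noncomputable def ricMat (m : ℕ) (Φ : (Fin m → ℂ) × (Fin m → ℂ) → ℂ) (i j : Fin m) :
    (Fin m → ℂ) × (Fin m → ℂ) → ℂ :=
  fun p => -(gMat m (detG m Φ) i j p)

/-- The Euclidean Laplacian of a real-valued function on `ℂ ≅ ℝ²`. -/
noncomputable def lap (v : ℂ → ℝ) (s : ℂ) : ℝ :=
  fderiv ℝ (fun t => fderiv ℝ v t 1) s 1 +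
    fderiv ℝ (fun t => fderiv ℝ v t Complex.I) s Complex.I

section PA1

open Polynomial
open scoped Differential

/-- extension of a derivation to the fraction field, as a ring hom into dual numbers -/
noncomputable def fracDualHom {A : Type*} (K : Type*) [CommRing A] [Field K] [Algebra A K]
    (d : Derivation ℤ A A) : A →+* TrivSqZeroExt K K where
  toFun a := TrivSqZeroExt.inl (algebraMap A K a) + TrivSqZeroExt.inr (algebraMap A K (d a))
  map_one' := by ext <;> simp
  map_mul' a b := by
    ext
    · simp
    · simp [mul_comm]
      simp only [Algebra.smul_def]; ring
  map_zero' := by ext <;> simp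
  map_add' a b := by
    ext
    · simp
    · simp
      simp only [Algebra.smul_def]; ring

noncomputable def fracDualLift {A : Type*} (K : Type*) [CommRing A] [IsDomain A] [Field K]
    [Algebra A K] [IsFractionRing A K] (d : Derivation ℤ A A) :
    K →+* TrivSqZeroExt K K :=
  IsLocalization.lift (M := nonZeroDivisors A) (g := fracDualHom K d) (by
    intro y
    rw [TrivSqZeroExt.isUnit_iff_isUnit_fst]
    have : (fracDualHom K d y).fst = algebraMap A K y := by simp [fracDualHom]
    rw [this]
    exact IsLocalization.map_units _ y)

lemma fracDualLift_alg {A : Type*} (K : Type*) [CommRing A] [IsDomain A] [Field K]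
    [Algebra A K] [IsFractionRing A K] (d : Derivation ℤ A A) (a : A) :
    fracDualLift K d (algebraMap A _ a) = fracDualHom K d a := by
  simp [fracDualLift]

lemma fracDualLift_fst {A : Type*} (K : Type*) [CommRing A] [IsDomain A] [Field K]
    [Algebra A K] [IsFractionRing A K] (d : Derivation ℤ A A)
    (x : K) : (fracDualLift K d x).fst = x := by
  have : (TrivSqZeroExt.fstHom ℤ K K).toRingHom.comp
      (fracDualLift K d) = RingHom.id _ := by
    apply IsLocalization.ringHom_ext (nonZeroDivisors A)
    ext a
    simp [fracDualLift_alg, fracDualHom]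
  exact congrArg (fun f => f x) this

noncomputable def fracDeriv {A : Type*} (K : Type*) [CommRing A] [IsDomain A] [Field K]
    [Algebra A K] [IsFractionRing A K] (d : Derivation ℤ A A) :
    Derivation ℤ K K :=
  Derivation.mk'
    { toFun := fun x => (fracDualLift K d x).snd
      map_add' := by simp
      map_smul' := by intro n x; simp } (by
    intro a b
    simp [fracDualLift_fst, mul_comm])

lemma fracDeriv_alg {A : Type*} (K : Type*) [CommRing A] [IsDomain A] [Field K]
    [Algebra A K] [IsFractionRing A K] (d : Derivation ℤ A A) (a : A) :
    fracDeriv K d (algebraMap A _ a) = algebraMap A _ (d a) := by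
  change (fracDualLift K d _).snd = _
  rw [fracDualLift_alg]; simp [fracDualHom]
  simp only [Algebra.smul_def, mul_one]

lemma galois_descent {F K : Type*} [Field F] [CharZero F] [Field K] [Algebra F K] [Differential F]
    [Differential K] [DifferentialAlgebra F K] [FiniteDimensional F K] [IsGalois F K]
    (a c₁ c₂ : F) (u₁ u₂ : K) (h₁ : u₁ ≠ 0) (h₂ : u₂ ≠ 0)
    (h : algebraMap F K a = algebraMap F K c₁ * Differential.logDeriv u₁ + algebraMap F K c₂ * Differential.logDeriv u₂) :
    ∃ (N : ℕ) (w₁ w₂ : F), N ≠ 0 ∧ w₁ ≠ 0 ∧ w₂ ≠ 0 ∧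
      N * a = c₁ * Differential.logDeriv w₁ + c₂ * Differential.logDeriv w₂ := by
  have key : ∀ u : K, u ≠ 0 → ∃ w : F, w ≠ 0 ∧
      algebraMap F K (Differential.logDeriv w) = ∑ e : Gal(K/F), e (Differential.logDeriv u) := by
    intro u hu
    refine ⟨Algebra.norm F u, Algebra.norm_ne_zero_iff.2 hu, ?_⟩
    rw [← Differential.logDeriv_algebraMap, Algebra.norm_eq_prod_automorphisms, Differential.logDeriv_prod]
    · apply Finset.sum_congr rfl
      intro e _
      simp [Differential.logDeriv, Differential.algEquiv_deriv']
    · intro e _; simpa using hu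
  obtain ⟨w₁, hw₁, e₁⟩ := key u₁ h₁
  obtain ⟨w₂, hw₂, e₂⟩ := key u₂ h₂
  refine ⟨Fintype.card Gal(K/F), w₁, w₂, Fintype.card_ne_zero, hw₁, hw₂, ?_⟩
  apply (algebraMap F K).injective
  rw [map_add, map_mul, map_mul, map_mul, e₁, e₂, Finset.mul_sum, Finset.mul_sum,
    ← Finset.sum_add_distrib]
  have : ∀ e : Gal(K/F), algebraMap F K a =
      algebraMap F K c₁ * e (Differential.logDeriv u₁) + algebraMap F K c₂ * e (Differential.logDeriv u₂) := by
    intro e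
    have := congrArg e h
    simpa using this
  rw [← Finset.sum_congr rfl (fun e _ => this e)]
  simp

lemma finite_descent {F K : Type*} [Field F] [CharZero F] [Field K] [Algebra F K] [Differential F]
    [Differential K] [DifferentialAlgebra F K] [FiniteDimensional F K]
    (a c₁ c₂ : F) (u₁ u₂ : K) (h₁ : u₁ ≠ 0) (h₂ : u₂ ≠ 0)
    (h : algebraMap F K a = algebraMap F K c₁ * Differential.logDeriv u₁ + algebraMap F K c₂ * Differential.logDeriv u₂) :
    ∃ (N : ℕ) (w₁ w₂ : F), N ≠ 0 ∧ w₁ ≠ 0 ∧ w₂ ≠ 0 ∧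
      N * a = c₁ * Differential.logDeriv w₁ + c₂ * Differential.logDeriv w₂ := by
  let map := IsAlgClosed.lift (M := AlgebraicClosure F) (R := F) (S := K)
  let K' := map.fieldRange
  have : FiniteDimensional F K' :=
    LinearMap.finiteDimensional_range map.toLinearMap
  let K'' := IntermediateField.normalClosure F K' (AlgebraicClosure F)
  have : FiniteDimensional F K'' := inferInstance
  let j : K →ₐ[F] K'' := (IntermediateField.inclusion (IntermediateField.le_normalClosure K')).comp
    map.rangeRestrict
  have hj : Function.Injective j := j.toRingHom.injective
  have hl : ∀ u, j (Differential.logDeriv u) = Differential.logDeriv (j u) := by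
    intro u
    simp only [Differential.logDeriv, map_div₀]
    rw [Differential.algHom_deriv' j hj]
  have hG : IsGalois F K'' := inferInstance
  refine galois_descent (K := K'') a c₁ c₂ (j u₁) (j u₂) ?_ ?_ ?_
  · simpa using h₁
  · simpa using h₂
  · have := congrArg j h
    simpa [hl] using this

lemma alg_descent {F K : Type*} [Field F] [CharZero F] [Field K] [Algebra F K] [Differential F]
    [Differential K] [DifferentialAlgebra F K] 
    (a c₁ c₂ : F) (u₁ u₂ : K) (h₁ : u₁ ≠ 0) (h₂ : u₂ ≠ 0)
    (i₁ : IsAlgebraic F u₁) (i₂ : IsAlgebraic F u₂)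
    (h : algebraMap F K a = algebraMap F K c₁ * Differential.logDeriv u₁ + algebraMap F K c₂ * Differential.logDeriv u₂) :
    ∃ (N : ℕ) (w₁ w₂ : F), N ≠ 0 ∧ w₁ ≠ 0 ∧ w₂ ≠ 0 ∧
      N * a = c₁ * Differential.logDeriv w₁ + c₂ * Differential.logDeriv w₂ := by
  let M : IntermediateField F K := IntermediateField.adjoin F {u₁, u₂}
  have : FiniteDimensional F M := IntermediateField.finiteDimensional_adjoin (by
    rintro x (rfl | rfl)
    · exact i₁.isIntegral
    · exact i₂.isIntegral)
  have m₁ : u₁ ∈ M := IntermediateField.subset_adjoin _ _ (by simp)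
  have m₂ : u₂ ∈ M := IntermediateField.subset_adjoin _ _ (by simp)
  refine finite_descent (K := M) a c₁ c₂ ⟨u₁, m₁⟩ ⟨u₂, m₂⟩ ?_ ?_ ?_
  · simpa [Subtype.ext_iff] using h₁
  · simpa [Subtype.ext_iff] using h₂
  · apply (algebraMap M K).injective
    rw [map_add, map_mul, map_mul, ← Differential.logDeriv_algebraMap, ← Differential.logDeriv_algebraMap]
    exact h

lemma no_log_rat (a b : ℂ) (N : ℕ) (hN : N ≠ 0) (p₁ q₁ p₂ q₂ : ℂ[X]) (h₁ : p₁ ≠ 0) (h₂ : q₁ ≠ 0)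
    (h₃ : p₂ ≠ 0) (h₄ : q₂ ≠ 0)
    (h : C (N : ℂ) * (p₁ * q₁ * p₂ * q₂) =
      C a * ((derivative p₁ * q₁ - p₁ * derivative q₁) * (p₂ * q₂)) +
      C b * ((derivative p₂ * q₂ - p₂ * derivative q₂) * (p₁ * q₁))) : False := by
  have hd : ∀ p q : ℂ[X], p ≠ 0 → q ≠ 0 →
      (derivative p * q).degree < (p * q).degree := by
    intro p q hp hq
    rw [degree_mul, degree_mul]
    exact WithBot.add_lt_add_right (by simpa using hq) (degree_derivative_lt hp)
  have hd2 : ∀ p q : ℂ[X], p ≠ 0 → q ≠ 0 →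
      (derivative p * q - p * derivative q).degree < (p * q).degree := by
    intro p q hp hq
    refine lt_of_le_of_lt (degree_sub_le _ _) (max_lt (hd p q hp hq) ?_)
    rw [mul_comm p, mul_comm p]; exact hd q p hq hp
  have hd3 : ∀ (c : ℂ) (x y z : ℂ[X]), x.degree < y.degree → z ≠ 0 →
      (C c * (x * z)).degree < (y * z).degree := by
    intro c x y z hxy hz
    refine lt_of_le_of_lt (b := (x * z).degree) (by
      by_cases hc : c = 0
      · simp [hc]
      · rw [degree_C_mul hc]) ?_
    rw [degree_mul, degree_mul]
    exact WithBot.add_lt_add_right (by simpa using hz) hxy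
  have e₁ := hd3 a _ _ _ (hd2 p₁ q₁ h₁ h₂) (mul_ne_zero h₃ h₄)
  have e₂ := hd3 b _ _ _ (hd2 p₂ q₂ h₃ h₄) (mul_ne_zero h₁ h₂)
  rw [mul_comm (p₂ * q₂)] at e₂
  have e₃ := lt_of_le_of_lt (degree_add_le _ _) (max_lt e₁ e₂)
  rw [← h, degree_C_mul (by exact_mod_cast hN)] at e₃
  rw [← mul_assoc] at e₃
  exact lt_irrefl _ e₃

lemma no_log_aux {A F K : Type*} [CommRing A] [IsDomain A] [Algebra ℂ[X] A] [FaithfulSMul ℂ[X] A]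
    [Field F] [Algebra ℂ[X] F] [IsFractionRing ℂ[X] F] [Field K] [Algebra A K]
    [IsFractionRing A K] [Algebra ℂ[X] K] [IsScalarTower ℂ[X] A K] [Algebra F K]
    [IsScalarTower ℂ[X] F K]
    (d : Derivation ℤ A A)
    (hd : ∀ p : ℂ[X], d (algebraMap ℂ[X] A p) = algebraMap ℂ[X] A (derivative p))
    (S R : A) (hS : S ≠ 0) (hR : R ≠ 0) (iS : IsAlgebraic ℂ[X] S) (iR : IsAlgebraic ℂ[X] R)
    (a b : ℂ) (h : S * R = algebraMap ℂ[X] A (C a) * (d S * R) + algebraMap ℂ[X] A (C b) * (d R * S)) :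
    False := by
  let _ : Differential F := ⟨fracDeriv F ((derivative' (R := ℂ)).restrictScalars ℤ)⟩
  let _ : Differential K := ⟨fracDeriv K d⟩
  have hFd : ∀ p : ℂ[X], (algebraMap ℂ[X] F p)′ = algebraMap ℂ[X] F (derivative p) :=
    fun p => fracDeriv_alg _ _ _
  have hKd : ∀ p : A, (algebraMap A K p)′ = algebraMap A K (d p) :=
    fun p => fracDeriv_alg _ _ _
  have hFK : ∀ p : ℂ[X], algebraMap F K (algebraMap ℂ[X] F p) = algebraMap A K (algebraMap ℂ[X] A p) := by
    intro p
    rw [← IsScalarTower.algebraMap_apply ℂ[X] F K, ← IsScalarTower.algebraMap_apply ℂ[X] A K]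
  have _ : DifferentialAlgebra F K := ⟨by
    intro x
    obtain ⟨p, q, hq, rfl⟩ := IsFractionRing.div_surjective (A := ℂ[X]) x
    rw [map_div₀, Derivation.leibniz_div, Derivation.leibniz_div]
    simp only [hFd, hKd, hFK, hd, map_div₀, map_sub, map_mul, map_pow, smul_eq_mul, map_inv₀]⟩
  have _ : CharZero F := charZero_of_injective_algebraMap (IsFractionRing.injective ℂ[X] F)
  have inj : Function.Injective (algebraMap A K) := IsFractionRing.injective A K
  obtain ⟨N, w₁, w₂, hN, hw₁, hw₂, e⟩ := alg_descent (F := F) (K := K) 1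
    (algebraMap ℂ[X] F (C a)) (algebraMap ℂ[X] F (C b)) (algebraMap A K S) (algebraMap A K R)
    ((map_ne_zero_iff _ inj).2 hS) ((map_ne_zero_iff _ inj).2 hR)
    ((IsFractionRing.isAlgebraic_iff ℂ[X] F K).1 (iS.algebraMap (A := K)))
    ((IsFractionRing.isAlgebraic_iff ℂ[X] F K).1 (iR.algebraMap (A := K))) (by
      have hS' := (map_ne_zero_iff _ inj).2 hS
      have hR' := (map_ne_zero_iff _ inj).2 hR
      have h' := congrArg (algebraMap A K) h
      simp only [map_mul, map_add] at h'
      rw [map_one, hFK, hFK, Differential.logDeriv, Differential.logDeriv, hKd, hKd]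
      field_simp
      rw [h']; ring)
  obtain ⟨p₁, q₁, hq₁, rfl⟩ := IsFractionRing.div_surjective (A := ℂ[X]) w₁
  obtain ⟨p₂, q₂, hq₂, rfl⟩ := IsFractionRing.div_surjective (A := ℂ[X]) w₂
  have injF : Function.Injective (algebraMap ℂ[X] F) := IsFractionRing.injective _ _
  have hp₁ : algebraMap ℂ[X] F p₁ ≠ 0 := fun h0 => hw₁ (by simp [h0])
  have hp₂ : algebraMap ℂ[X] F p₂ ≠ 0 := fun h0 => hw₂ (by simp [h0])
  have hq₁ : algebraMap ℂ[X] F q₁ ≠ 0 := fun h0 => hw₁ (by simp [h0])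
  have hq₂ : algebraMap ℂ[X] F q₂ ≠ 0 := fun h0 => hw₂ (by simp [h0])
  refine no_log_rat a b N hN p₁ q₁ p₂ q₂ ((map_ne_zero_iff _ injF).1 hp₁)
    ((map_ne_zero_iff _ injF).1 hq₁) ((map_ne_zero_iff _ injF).1 hp₂)
    ((map_ne_zero_iff _ injF).1 hq₂) ?_
  apply injF
  rw [Differential.logDeriv_div _ _ hp₁ hq₁, Differential.logDeriv_div _ _ hp₂ hq₂] at e
  simp only [Differential.logDeriv, hFd] at e
  simp only [map_mul, map_add, map_sub]
  have : algebraMap ℂ[X] F (C (N : ℂ)) = (N : F) := by simp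
  rw [this]
  field_simp at e
  linear_combination e


lemma no_log {A : Type*} [CommRing A] [IsDomain A] [Algebra ℂ[X] A] [FaithfulSMul ℂ[X] A]
    (d : Derivation ℤ A A)
    (hd : ∀ p : ℂ[X], d (algebraMap ℂ[X] A p) = algebraMap ℂ[X] A (derivative p))
    (S R : A) (hS : S ≠ 0) (hR : R ≠ 0) (iS : IsAlgebraic ℂ[X] S) (iR : IsAlgebraic ℂ[X] R)
    (a b : ℂ) (h : S * R = algebraMap ℂ[X] A (C a) * (d S * R) + algebraMap ℂ[X] A (C b) * (d R * S)) :
    False := by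
  let _ : Algebra (FractionRing ℂ[X]) (FractionRing A) := FractionRing.liftAlgebra ℂ[X] (FractionRing A)
  have _ : IsScalarTower ℂ[X] (FractionRing ℂ[X]) (FractionRing A) :=
    FractionRing.isScalarTower_liftAlgebra ℂ[X] (FractionRing A)
  exact no_log_aux (F := FractionRing ℂ[X]) (K := FractionRing A) d hd S R hS hR iS iR a b h

end PA1

section PB1

open Polynomial Topology

lemma continuous_evalEval (p : ℂ[X][X]) : Continuous fun z : ℂ × ℂ => p.evalEval z.1 z.2 := by
  induction p using Polynomial.induction_on' with
  | add p q hp hq => simp only [evalEval_add]; exact hp.add hq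
  | monomial n a =>
    have : (fun z : ℂ × ℂ => (monomial n a : ℂ[X][X]).evalEval z.1 z.2)
        = fun z : ℂ × ℂ => a.eval z.1 * z.2 ^ n := by
      funext z
      rw [← C_mul_X_pow_eq_monomial, evalEval_mul, evalEval_pow, evalEval_X, evalEval_C]
    rw [this]
    exact (a.continuous.comp continuous_fst).mul (continuous_snd.pow n)

lemma eval_swap0 {S : Type*} [CommRing S] (Q : S[X][X]) :
    Q.eval (C 0) = (Bivariate.swap Q).map (evalRingHom 0) := by
  induction Q using Polynomial.induction_on' with
  | add p q hp hq => rw [eval_add, hp, hq, map_add, Polynomial.map_add]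
  | monomial n a =>
    rw [← C_mul_X_pow_eq_monomial, map_mul, map_pow, Bivariate.swap_Y, Bivariate.swap_C,
      Polynomial.map_mul, Polynomial.map_pow, Polynomial.map_C, Polynomial.map_map]
    have : (evalRingHom (0:S)).comp C = RingHom.id S := by ext; simp
    rw [this]
    simp

lemma eta_factor {S : Type*} [CommRing S] [IsDomain S] (W : S[X][X]) (hW : W ≠ 0) :
    ∃ (k : ℕ) (W1 : S[X][X]), W = (C X) ^ k * W1 ∧ W1.map (evalRingHom 0) ≠ 0 := by
  obtain ⟨Q1, h1, h2⟩ := Polynomial.exists_eq_pow_rootMultiplicity_mul_and_not_dvd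
    (Bivariate.swap W) (by simpa using hW) 0
  refine ⟨rootMultiplicity 0 (Bivariate.swap W), Bivariate.swap Q1, ?_, ?_⟩
  · have := congrArg (Bivariate.swap (R := S)) h1
    rw [Bivariate.swap_swap_apply, map_mul, map_pow, map_zero, sub_zero, Bivariate.swap_Y] at this
    exact this
  · rw [dvd_iff_isRoot, IsRoot] at h2
    intro h
    apply h2
    rw [← map_zero C, eval_swap0, h, map_zero]

/-- derivations preserve algebraicity -/
lemma deriv_alg {R A : Type*} [CommRing R] [IsDomain R] [CommRing A] [IsDomain A] [CharZero A]
    [Algebra R A] (hinj : Function.Injective (algebraMap R A)) (d : Derivation ℤ A A)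
    (hd : ∀ r : R, IsAlgebraic R (d (algebraMap R A r)))
    (f : A) (hf : IsAlgebraic R f) : IsAlgebraic R (d f) := by
  classical
  have key : ∀ P : R[X], IsAlgebraic R (d (aeval f P) - aeval f (derivative P) * d f) := by
    intro P
    induction P using Polynomial.induction_on' with
    | add p q hp hq =>
      have := hp.add hq
      convert this using 1
      simp only [map_add]; ring
    | monomial n a =>
      have h1 : IsAlgebraic R (d (algebraMap R A a) * f ^ n) := (hd a).mul (hf.pow n)
      convert h1 using 1
      rw [aeval_monomial, derivative_monomial, aeval_monomial, Derivation.leibniz, Derivation.leibniz_pow]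
      simp only [smul_eq_mul, map_mul, map_natCast, nsmul_eq_mul]
      ring
  have hex : ∃ n, ∃ P : R[X], P ≠ 0 ∧ aeval f P = 0 ∧ P.natDegree = n := by
    obtain ⟨P, h1, h2⟩ := hf
    exact ⟨_, P, h1, h2, rfl⟩
  obtain ⟨P, h1, h2, h3⟩ := Nat.find_spec hex
  have hne : P.natDegree ≠ 0 := by
    intro h0
    rw [natDegree_eq_zero] at h0
    obtain ⟨c, rfl⟩ := h0
    rw [aeval_C] at h2
    exact h1 (by rw [hinj (h2.trans (map_zero _).symm), map_zero])
  have hder : aeval f (derivative P) ≠ 0 := by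
    intro h0
    have hd0 : derivative P ≠ 0 := by
      intro h
      have : CharZero R := by
        refine ⟨fun a b hab => ?_⟩
        have := congrArg (algebraMap R A) hab
        simpa using this
      exact hne (derivative_eq_zero.1 h)
    refine Nat.find_min hex (m := (derivative P).natDegree) ?_ ⟨_, hd0, h0, rfl⟩
    rw [← h3]
    exact natDegree_derivative_lt hne
  have h4 := key P
  rw [h2, map_zero, zero_sub] at h4
  have h5 : IsAlgebraic R (aeval f (derivative P) * d f) := by simpa using h4.neg
  refine IsAlgebraic.of_mul (mem_nonZeroDivisors_of_ne_zero hder) ?_ ?_ (z := d f)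
  · have : ∀ Q : R[X], IsAlgebraic R (aeval f Q) := by
      intro Q
      induction Q using Polynomial.induction_on' with
      | add p q hp hq => rw [map_add]; exact hp.add hq
      | monomial n a => rw [aeval_monomial]; exact (isAlgebraic_algebraMap a).mul (hf.pow n)
    exact this _
  · simpa [mul_comm] using h5

end PB1

section PB2

open Polynomial Topology

/-- holomorphic functions on a set -/
def hol {E : Type*} [NormedAddCommGroup E] [NormedSpace ℂ E] (B : Set E) : Subalgebra ℂ (B → ℂ) where
  carrier := {f | ∃ F : E → ℂ, AnalyticOnNhd ℂ F B ∧ ∀ x : B, f x = F x}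
  mul_mem' := by
    rintro f g ⟨F, h1, h2⟩ ⟨F', h1', h2'⟩
    exact ⟨F * F', h1.mul h1', fun x => by simp [h2, h2']⟩
  add_mem' := by
    rintro f g ⟨F, h1, h2⟩ ⟨F', h1', h2'⟩
    exact ⟨F + F', h1.add h1', fun x => by simp [h2, h2']⟩
  algebraMap_mem' r := ⟨fun _ => r, analyticOnNhd_const, fun _ => rfl⟩

section
variable {E : Type*} [NormedAddCommGroup E] [NormedSpace ℂ E] {B : Set E}

def holMk (B : Set E) (F : E → ℂ) (h : AnalyticOnNhd ℂ F B) : hol B := ⟨fun x => F x, F, h, fun _ => rfl⟩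

lemma hol_exists (f : hol B) : ∃ F, ∃ h : AnalyticOnNhd ℂ F B, f = holMk B F h := by
  obtain ⟨f, F, h, h'⟩ := f
  exact ⟨F, h, Subtype.ext (funext h')⟩

lemma holMk_eq_iff {F F' : E → ℂ} {h : AnalyticOnNhd ℂ F B} {h' : AnalyticOnNhd ℂ F' B} :
    holMk B F h = holMk B F' h' ↔ ∀ x ∈ B, F x = F' x := by
  constructor
  · intro e x hx
    exact congrFun (congrArg Subtype.val e) ⟨x, hx⟩
  · intro e
    exact Subtype.ext (funext fun x => e x x.2)

/-- evaluation at a point -/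
def holEv (x : E) (hx : x ∈ B) : hol B →ₐ[ℂ] ℂ :=
  (Pi.evalAlgHom ℂ (fun _ : B => ℂ) ⟨x, hx⟩).comp (hol B).val

@[simp] lemma holEv_mk (x : E) (hx : x ∈ B) (F : E → ℂ) (h : AnalyticOnNhd ℂ F B) :
    holEv x hx (holMk B F h) = F x := rfl

lemma hol_ext {f g : hol B} (h : ∀ x (hx : x ∈ B), holEv x hx f = holEv x hx g) : f = g :=
  Subtype.ext (funext fun x => h x x.2)

lemma hol_isDomain (hBo : IsOpen B) (hB : IsPreconnected B) (hne : B.Nonempty) : IsDomain (hol B) := by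
  have : Nontrivial (hol B) := by
    obtain ⟨x, hx⟩ := hne
    exact (holEv x hx).toRingHom.domain_nontrivial
  have : NoZeroDivisors (hol B) := by
    refine ⟨?_⟩
    intro a b hab
    obtain ⟨F, hF, rfl⟩ := hol_exists a
    obtain ⟨F', hF', rfl⟩ := hol_exists b
    by_cases h : ∀ x ∈ B, F x = 0
    · left; exact hol_ext fun x hx => by simpa using h x hx
    right
    push Not at h
    obtain ⟨x, hx, hne⟩ := h
    have hF'0 : B.EqOn F' 0 := by
      apply hF'.eqOn_zero_of_preconnected_of_eventuallyEq_zero hB hx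
      have h1 : ∀ᶠ y in 𝓝 x, F y ≠ 0 := (hF x hx).continuousAt.eventually_ne hne
      filter_upwards [h1, hBo.mem_nhds hx] with y hy hyB
      have := congrArg (holEv y hyB) hab
      simpa [hy] using this
    exact hol_ext fun x hx => by simpa using hF'0 hx
  exact NoZeroDivisors.to_isDomain _

variable {σ : Type*}

lemma clm_analyticOnNhd (l : E →L[ℂ] ℂ) (B : Set E) : AnalyticOnNhd ℂ (fun x => l x) B :=
  fun x _ => l.analyticAt x

noncomputable def coordHom (c : σ → E →L[ℂ] ℂ) (B : Set E) : MvPolynomial σ ℂ →ₐ[ℂ] hol B :=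
  MvPolynomial.aeval (fun i => holMk B (c i) (clm_analyticOnNhd (c i) B))

noncomputable abbrev coordAlg (c : σ → E →L[ℂ] ℂ) (B : Set E) : Algebra (MvPolynomial σ ℂ) (hol B) :=
  (coordHom c B).toRingHom.toAlgebra

lemma holEv_coordHom (c : σ → E →L[ℂ] ℂ) (x : E) (hx : x ∈ B) (p : MvPolynomial σ ℂ) :
    holEv x hx (coordHom c B p) = MvPolynomial.eval (fun i => c i x) p := by
  have : (holEv x hx).comp (coordHom c B) = MvPolynomial.aeval (fun i => c i x) := by
    ext i
    simp only [coordHom, AlgHom.comp_apply, MvPolynomial.aeval_X]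
    rfl
  rw [← AlgHom.comp_apply, this]
  simp [MvPolynomial.aeval_eq_eval]

/-- Coordinates are jointly surjective. -/
def CSurj (c : σ → E →L[ℂ] ℂ) : Prop := ∀ p : σ → ℂ, ∃ e, ∀ i, c i e = p i

lemma analytic_coord_eval (c : σ → E →L[ℂ] ℂ) (p : MvPolynomial σ ℂ) :
    AnalyticOnNhd ℂ (fun x => MvPolynomial.eval (fun i => c i x) p) Set.univ := by
  induction p using MvPolynomial.induction_on with
  | C a => simpa using analyticOnNhd_const
  | add p q hp hq => simp only [map_add]; exact hp.add hq
  | mul_X p i hp =>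
    simp only [map_mul, MvPolynomial.eval_X]
    exact hp.mul (fun x _ => (c i).analyticAt x)

lemma coordHom_inj (c : σ → E →L[ℂ] ℂ) (hc : CSurj c) (hBo : IsOpen B) (hne : B.Nonempty) :
    Function.Injective (coordHom c B) := by
  rw [injective_iff_map_eq_zero]
  intro p hp
  obtain ⟨x0, hx0⟩ := hne
  have h0 : ∀ x ∈ B, MvPolynomial.eval (fun i => c i x) p = 0 := by
    intro x hx
    rw [← holEv_coordHom c x hx, hp, map_zero]
  have := (analytic_coord_eval c p).eqOn_zero_of_preconnected_of_eventuallyEq_zero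
    isPreconnected_univ (Set.mem_univ x0) (by
      filter_upwards [hBo.mem_nhds hx0] with y hy using h0 y hy)
  apply MvPolynomial.funext
  intro q
  obtain ⟨e, he⟩ := hc q
  have h2 := this (Set.mem_univ e)
  simp only [he] at h2
  simpa using h2

/-- Nash functions -/
def NashOn (c : σ → E →L[ℂ] ℂ) (B : Set E) (f : E → ℂ) : Prop :=
  AnalyticOnNhd ℂ f B ∧ ∃ P : Polynomial (MvPolynomial σ ℂ), P ≠ 0 ∧
    ∀ x ∈ B, (P.map (MvPolynomial.eval (fun i => c i x))).eval (f x) = 0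

lemma NashOn.mono {c : σ → E →L[ℂ] ℂ} {B' : Set E} {f : E → ℂ} (h : NashOn c B f) (hB : B' ⊆ B) :
    NashOn c B' f := by
  obtain ⟨h1, P, h2, h3⟩ := h
  exact ⟨h1.mono hB, P, h2, fun x hx => h3 x (hB hx)⟩

lemma NashOn.congr {c : σ → E →L[ℂ] ℂ} {f g : E → ℂ} (hBo : IsOpen B) (h : NashOn c B f)
    (hfg : ∀ x ∈ B, f x = g x) : NashOn c B g := by
  obtain ⟨h1, P, h2, h3⟩ := h
  exact ⟨h1.congr hBo hfg, P, h2, fun x hx => by rw [← hfg x hx]; exact h3 x hx⟩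

lemma holEv_aeval (c : σ → E →L[ℂ] ℂ) (P : Polynomial (MvPolynomial σ ℂ)) (f : E → ℂ)
    (hf : AnalyticOnNhd ℂ f B) (x : E) (hx : x ∈ B) :
    holEv x hx (P.eval₂ (coordHom c B).toRingHom (holMk B f hf)) =
      (P.map (MvPolynomial.eval (fun i => c i x))).eval (f x) := by
  rw [show holEv x hx (P.eval₂ (coordHom c B).toRingHom (holMk B f hf)) =
    (holEv x hx).toRingHom (P.eval₂ (coordHom c B).toRingHom (holMk B f hf)) from rfl,
    Polynomial.hom_eval₂, Polynomial.eval_map]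
  congr 1
  ext p
  · exact holEv_coordHom c x hx _
  · exact holEv_coordHom c x hx _

lemma nashOn_iff {c : σ → E →L[ℂ] ℂ} {f : E → ℂ} (hf : AnalyticOnNhd ℂ f B) :
    NashOn c B f ↔ @IsAlgebraic (MvPolynomial σ ℂ) (hol B) _ _ (coordAlg c B) (holMk B f hf) := by
  let _ := coordAlg c B
  constructor
  · rintro ⟨-, P, h1, h2⟩
    refine ⟨P, h1, hol_ext fun x hx => ?_⟩
    rw [map_zero, ← h2 x hx, ← holEv_aeval c P f hf x hx]
    rfl
  · rintro ⟨P, h1, h2⟩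
    refine ⟨hf, P, h1, fun x hx => ?_⟩
    rw [← holEv_aeval c P f hf x hx]
    have := congrArg (holEv x hx) h2
    rw [map_zero] at this
    exact this

lemma NashOn.add {c : σ → E →L[ℂ] ℂ} {f g : E → ℂ} (hf : NashOn c B f) (hg : NashOn c B g) :
    NashOn c B (fun x => f x + g x) := by
  let _ := coordAlg c B
  refine (nashOn_iff (f := fun x => f x + g x) (hf.1.add hg.1)).2 ?_
  exact ((nashOn_iff hf.1).1 hf).add ((nashOn_iff hg.1).1 hg)

lemma NashOn.mul {c : σ → E →L[ℂ] ℂ} {f g : E → ℂ} (hf : NashOn c B f) (hg : NashOn c B g) :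
    NashOn c B (fun x => f x * g x) := by
  let _ := coordAlg c B
  refine (nashOn_iff (f := fun x => f x * g x) (hf.1.mul hg.1)).2 ?_
  exact ((nashOn_iff hf.1).1 hf).mul ((nashOn_iff hg.1).1 hg)

lemma NashOn.const (c : σ → E →L[ℂ] ℂ) (a : ℂ) : NashOn c B (fun _ => a) := by
  refine ⟨analyticOnNhd_const, X - C (MvPolynomial.C a), X_sub_C_ne_zero _, fun x hx => by simp⟩

lemma NashOn.coord (c : σ → E →L[ℂ] ℂ) (i : σ) : NashOn c B (fun x => c i x) := by
  refine ⟨fun x _ => (c i).analyticAt x, X - C (MvPolynomial.X i), X_sub_C_ne_zero _, fun x hx => by simp⟩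

lemma NashOn.neg {c : σ → E →L[ℂ] ℂ} {f : E → ℂ} (hf : NashOn c B f) :
    NashOn c B (fun x => - f x) := by
  have := (NashOn.const (B := B) c (-1)).mul hf
  simpa using this

lemma NashOn.sub {c : σ → E →L[ℂ] ℂ} {f g : E → ℂ} (hf : NashOn c B f) (hg : NashOn c B g) :
    NashOn c B (fun x => f x - g x) := by
  simpa [sub_eq_add_neg] using hf.add hg.neg

lemma NashOn.sum {c : σ → E →L[ℂ] ℂ} {ι : Type*} (s : Finset ι) {f : ι → E → ℂ}
    (hf : ∀ i ∈ s, NashOn c B (f i)) : NashOn c B (fun x => ∑ i ∈ s, f i x) := by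
  classical
  induction s using Finset.induction_on with
  | empty => simpa using NashOn.const c 0
  | insert a s ha ih =>
    simp only [Finset.sum_insert ha]
    exact (hf a (by simp)).add (ih fun i hi => hf i (by simp [hi]))

lemma NashOn.prod {c : σ → E →L[ℂ] ℂ} {ι : Type*} (s : Finset ι) {f : ι → E → ℂ}
    (hf : ∀ i ∈ s, NashOn c B (f i)) : NashOn c B (fun x => ∏ i ∈ s, f i x) := by
  classical
  induction s using Finset.induction_on with
  | empty => simpa using NashOn.const c 1
  | insert a s ha ih =>
    simp only [Finset.prod_insert ha]
    exact (hf a (by simp)).mul (ih fun i hi => hf i (by simp [hi]))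

lemma NashOn.inv {c : σ → E →L[ℂ] ℂ} {f : E → ℂ} (hf : NashOn c B f) (h0 : ∀ x ∈ B, f x ≠ 0) :
    NashOn c B (fun x => (f x)⁻¹) := by
  let _ := coordAlg c B
  have hi : AnalyticOnNhd ℂ (fun x => (f x)⁻¹) B := hf.1.inv h0
  rw [nashOn_iff hi]
  have h1 : holMk B f hf.1 * holMk B _ hi = 1 := hol_ext fun x hx => by
    simp [mul_inv_cancel₀ (h0 x hx)]
  refine IsAlgebraic.of_mul (IsUnit.mem_nonZeroDivisors (IsUnit.of_mul_eq_one _ h1))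
    ((nashOn_iff hf.1).1 hf) ?_
  erw [h1]
  exact isAlgebraic_one

lemma NashOn.zero_lemma {c : σ → E →L[ℂ] ℂ} {f : E → ℂ} (hBo : IsOpen B) (hB : IsPreconnected B)
    (hf : NashOn c B f) (x : E) (hx : x ∈ B) (h0 : f x ≠ 0) :
    ∃ P : Polynomial (MvPolynomial σ ℂ), P.coeff 0 ≠ 0 ∧
    ∀ x ∈ B, (P.map (MvPolynomial.eval (fun i => c i x))).eval (f x) = 0 := by
  let _ := coordAlg c B
  have := hol_isDomain hBo hB ⟨x, hx⟩
  obtain ⟨P, h1, h2⟩ := ((nashOn_iff hf.1).1 hf).exists_nonzero_coeff_and_aeval_eq_zero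
    (mem_nonZeroDivisors_of_ne_zero (fun h => h0 (by
      have := congrArg (holEv x hx) h
      simpa using this)))
  refine ⟨P, h1, fun x hx => ?_⟩
  rw [← holEv_aeval c P f hf.1 x hx]
  have := congrArg (holEv x hx) h2
  rw [map_zero] at this
  exact this

end

end PB2

section PB3

open Polynomial Topology

section
variable {E : Type*} [NormedAddCommGroup E] [NormedSpace ℂ E] {B : Set E}

lemma analytic_fderiv_apply {F : E → ℂ} (h : AnalyticOnNhd ℂ F B) (v : E) :
    AnalyticOnNhd ℂ (fun x => fderiv ℂ F x v) B := by
  intro x hx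
  have h1 := h.fderiv x hx
  exact ((ContinuousLinearMap.apply ℂ ℂ v).analyticAt _).comp h1

noncomputable def holD0 (v : E) (f : hol B) : hol B :=
  holMk B (fun x => fderiv ℂ (Classical.choose (hol_exists f)) x v)
    (analytic_fderiv_apply (Classical.choose (Classical.choose_spec (hol_exists f))) v)

lemma holD0_mk (hBo : IsOpen B) (v : E) (F : E → ℂ) (h : AnalyticOnNhd ℂ F B) :
    holD0 v (holMk B F h) = holMk B (fun x => fderiv ℂ F x v) (analytic_fderiv_apply h v) := by
  unfold holD0
  rw [holMk_eq_iff]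
  intro x hx
  have h1 := Classical.choose_spec (Classical.choose_spec (hol_exists (holMk B F h)))
  rw [holMk_eq_iff] at h1
  rw [Filter.EventuallyEq.fderiv_eq]
  filter_upwards [hBo.mem_nhds hx] with y hy using (h1 y hy).symm

lemma holD0_add (hBo : IsOpen B) (v : E) (f g : hol B) : holD0 v (f + g) = holD0 v f + holD0 v g := by
  obtain ⟨F, hF, rfl⟩ := hol_exists f
  obtain ⟨G, hG, rfl⟩ := hol_exists g
  have : holMk B F hF + holMk B G hG = holMk B (fun x => F x + G x) (hF.add hG) := rfl
  rw [this, holD0_mk hBo, holD0_mk hBo, holD0_mk hBo]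
  refine hol_ext fun x hx => ?_
  simp only [holEv_mk, map_add]
  rw [fderiv_fun_add (hF x hx).differentiableAt (hG x hx).differentiableAt]
  rfl

lemma holD0_mul (hBo : IsOpen B) (v : E) (f g : hol B) :
    holD0 v (f * g) = f * holD0 v g + g * holD0 v f := by
  obtain ⟨F, hF, rfl⟩ := hol_exists f
  obtain ⟨G, hG, rfl⟩ := hol_exists g
  have : holMk B F hF * holMk B G hG = holMk B (fun x => F x * G x) (hF.mul hG) := rfl
  rw [this, holD0_mk hBo, holD0_mk hBo, holD0_mk hBo]
  refine hol_ext fun x hx => ?_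
  simp only [holEv_mk, map_add, map_mul]
  rw [fderiv_fun_mul (hF x hx).differentiableAt (hG x hx).differentiableAt]
  rfl

noncomputable def holD (hBo : IsOpen B) (v : E) : Derivation ℤ (hol B) (hol B) :=
  Derivation.mk' (AddMonoidHom.mk' (holD0 v) (holD0_add hBo v)).toIntLinearMap
    (fun f g => holD0_mul hBo v f g)

lemma holD_mk (hBo : IsOpen B) (v : E) (F : E → ℂ) (h : AnalyticOnNhd ℂ F B) :
    holD hBo v (holMk B F h) = holMk B (fun x => fderiv ℂ F x v) (analytic_fderiv_apply h v) :=
  holD0_mk hBo v F h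

variable {σ : Type*}

lemma nash_fderiv {c : σ → E →L[ℂ] ℂ} (hc : CSurj c) (hBo : IsOpen B) (hB : IsPreconnected B)
    {f : E → ℂ} (hf : NashOn c B f) (v : E) : NashOn c B (fun x => fderiv ℂ f x v) := by
  rcases Set.eq_empty_or_nonempty B with rfl | hne
  · exact ⟨fun x hx => hx.elim, 1, one_ne_zero, fun x hx => hx.elim⟩
  let _ := coordAlg c B
  have := hol_isDomain hBo hB hne
  have : CharZero (hol B) := algebraRat.charZero _
  rw [nashOn_iff (analytic_fderiv_apply hf.1 v)]
  have h1 := (nashOn_iff hf.1).1 hf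
  rw [← holD_mk hBo v f hf.1]
  have hinj : Function.Injective (algebraMap (MvPolynomial σ ℂ) (hol B)) := coordHom_inj c hc hBo hne
  refine deriv_alg hinj (holD hBo v) ?_ _ h1
  intro p
  change IsAlgebraic _ (holD hBo v (coordHom c B p))
  induction p using MvPolynomial.induction_on with
  | C a =>
    have : coordHom c B (MvPolynomial.C a) = holMk B (fun _ => a) analyticOnNhd_const := by
      simp [coordHom]; rfl
    rw [this, holD_mk, ← nashOn_iff]
    simpa using NashOn.const c 0
  | add p q hp hq => rw [map_add, map_add]; exact hp.add hq
  | mul_X p i hp =>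
    rw [map_mul, Derivation.leibniz]
    simp only [smul_eq_mul]
    refine (isAlgebraic_algebraMap (A := hol B) p).mul ?_ |>.add ((isAlgebraic_algebraMap (A := hol B) (MvPolynomial.X i)).mul hp)
    have : coordHom c B (MvPolynomial.X i) = holMk B (c i) (clm_analyticOnNhd (c i) B) := by
      simp [coordHom]
    rw [this, holD_mk, ← nashOn_iff]
    simpa using NashOn.const c (c i v)

end
section
variable {E : Type*} [NormedAddCommGroup E] [NormedSpace ℂ E] {B : Set E}
variable {E' : Type*} [NormedAddCommGroup E'] [NormedSpace ℂ E'] {B' : Set E'}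
variable {σ σ' : Type*}

lemma NashOn.comp {c : σ → E →L[ℂ] ℂ} {c' : σ' → E' →L[ℂ] ℂ} (hc : CSurj c)
    (hBo : IsOpen B) (hBo' : IsOpen B') (hB' : IsPreconnected B')
    {f : E → ℂ} (hf : NashOn c B f) {q : E' → E} (hq : ∀ x ∈ B', q x ∈ B)
    (hqa : AnalyticOnNhd ℂ q B') (hqN : ∀ i, NashOn c' B' (fun x => c i (q x))) :
    NashOn c' B' (fun x => f (q x)) := by
  have hfq : AnalyticOnNhd ℂ (fun x => f (q x)) B' := fun x hx => (hf.1 _ (hq x hx)).comp (hqa x hx)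
  rcases Set.eq_empty_or_nonempty B' with rfl | ⟨x0, hx0⟩
  · exact ⟨fun x hx => hx.elim, 1, one_ne_zero, fun x hx => hx.elim⟩
  let _ := coordAlg c' B'
  have := hol_isDomain hBo' hB' ⟨x0, hx0⟩
  obtain ⟨hfa, P, hP, hPf⟩ := hf
  -- a point where P is nonzero
  have hp : ∃ p : σ → ℂ, P.map (MvPolynomial.eval p) ≠ 0 := by
    by_contra! h
    apply hP
    ext1 i
    apply MvPolynomial.funext
    intro p
    have := congrArg (fun Q => Q.coeff i) (h p)
    simpa using this
  obtain ⟨p, hp⟩ := hp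
  obtain ⟨e, he⟩ := hc p
  set w := e - q x0 with hw
  let S := Subalgebra.algebraicClosure (MvPolynomial σ' ℂ) (hol B')
  let qi : σ → S := fun i => ⟨holMk B' (fun x => c i (q x)) (hqN i).1, (nashOn_iff (hqN i).1).1 (hqN i)⟩
  let cst : ℂ →+* S :=
    { toFun := fun a => ⟨holMk B' (fun _ => a) analyticOnNhd_const,
        (nashOn_iff analyticOnNhd_const).1 (NashOn.const c' a)⟩
      map_one' := rfl
      map_mul' := fun _ _ => rfl
      map_zero' := rfl
      map_add' := fun _ _ => rfl }
  let φ : MvPolynomial σ ℂ →+* S[X] :=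
    MvPolynomial.eval₂Hom (C.comp cst) (fun i => C (qi i) + C (cst (c i w)) * X)
  let ev : ∀ x, x ∈ B' → (S →+* ℂ) := fun x hx => (holEv x hx).toRingHom.comp S.subtype
  have hev : ∀ x hx (η : ℂ) (r : MvPolynomial σ ℂ),
      ((φ r).map (ev x hx)).eval η = MvPolynomial.eval (fun i => c i (q x + η • w)) r := by
    intro x hx η r
    have : ((evalRingHom η).comp (mapRingHom (ev x hx))).comp φ =
        MvPolynomial.eval (fun i => c i (q x + η • w)) := by
      apply MvPolynomial.ringHom_ext
      · intro a
        simp only [φ, RingHom.comp_apply, MvPolynomial.eval₂Hom_C, coe_mapRingHom, map_C, coe_evalRingHom, eval_C, MvPolynomial.eval_C]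
        rfl
      · intro i
        simp only [φ, RingHom.comp_apply, MvPolynomial.eval₂Hom_X', coe_mapRingHom, Polynomial.map_add, Polynomial.map_mul, map_C, map_X, coe_evalRingHom, eval_C, eval_add, eval_mul, eval_X, MvPolynomial.eval_X]
        change c i (q x) + c i w * η = _
        simp [mul_comm]
    exact congrArg (fun f => f r) this
  have hev2 : ∀ x hx (η y : ℂ), ((P.map φ).map (mapRingHom (ev x hx))).evalEval η y =
      (P.map (MvPolynomial.eval (fun i => c i (q x + η • w)))).eval y := by
    intro x hx η y
    rw [← map_evalRingHom_eval, Polynomial.map_map, Polynomial.map_map]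
    congr 2
    exact RingHom.ext (fun r => hev x hx η r)
  have hW : P.map φ ≠ 0 := by
    intro h0
    apply hp
    apply Polynomial.funext
    intro y
    have := hev2 x0 hx0 1 y
    rw [h0] at this
    simp only [Polynomial.map_zero, evalEval_zero, one_smul] at this
    rw [eval_zero, this]
    congr 3
    ext i
    rw [← he]; simp [hw]
  obtain ⟨k, W1, hW1, hW0⟩ := eta_factor (S := S) (P.map φ) hW
  refine (nashOn_iff hfq).2 ?_
  refine IsAlgebraic.restrictScalars (MvPolynomial σ' ℂ) (S := S) ?_
  refine ⟨W1.map (evalRingHom 0), hW0, hol_ext fun x hx => ?_⟩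
  have h1 : holEv x hx (aeval (holMk B' (fun x => f (q x)) hfq) (W1.map (evalRingHom 0))) =
      ((W1.map (mapRingHom (ev x hx)))).evalEval 0 (f (q x)) := by
    rw [← map_evalRingHom_eval, Polynomial.map_map, aeval_def]
    change (holEv x hx).toRingHom _ = _
    rw [Polynomial.hom_eval₂, Polynomial.eval₂_map, Polynomial.eval_map]
    congr 1
    ext r
    · simp; rfl
    · simp
  rw [h1, map_zero]
  have hlim : Filter.Tendsto (fun η : ℂ => (W1.map (mapRingHom (ev x hx))).evalEval η (f (q x + η • w)))
      (𝓝[≠] 0) (𝓝 ((W1.map (mapRingHom (ev x hx))).evalEval 0 (f (q x)))) := by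
    refine tendsto_nhdsWithin_of_tendsto_nhds ?_
    have hcont : ContinuousAt (fun η : ℂ => ((η, f (q x + η • w)) : ℂ × ℂ)) 0 := by
      refine continuousAt_id.prodMk ?_
      have h1 : ContinuousAt (fun η : ℂ => q x + η • w) 0 := by fun_prop
      refine ContinuousAt.comp (g := f) ?_ h1
      simpa using (hfa _ (hq x hx)).continuousAt
    have := (continuous_evalEval (W1.map (mapRingHom (ev x hx)))).continuousAt.comp hcont
    unfold ContinuousAt at this
    simpa [Function.comp_def] using this
  refine tendsto_nhds_unique hlim (tendsto_const_nhds.congr' ?_)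
  have hB : ∀ᶠ η : ℂ in 𝓝[≠] 0, q x + η • w ∈ B := by
    apply nhdsWithin_le_nhds
    have : ContinuousAt (fun η : ℂ => q x + η • w) 0 := by fun_prop
    apply this.eventually_mem
    simpa using hBo.mem_nhds (hq x hx)
  filter_upwards [hB, self_mem_nhdsWithin] with η h1 h2
  have h3 := hev2 x hx η (f (q x + η • w))
  rw [hPf _ h1, hW1, Polynomial.map_mul, evalEval_mul, Polynomial.map_pow, evalEval_pow] at h3
  simp only [map_C, coe_mapRingHom, map_X, evalEval_C, eval_X] at h3
  rcases mul_eq_zero.1 h3 with h4 | h4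
  · exact absurd h4 (pow_ne_zero k h2)
  · exact h4.symm
end

end PB3

section PB4

open Polynomial Topology

noncomputable def c1 : Unit → ℂ →L[ℂ] ℂ := fun _ => ContinuousLinearMap.id ℂ ℂ

lemma c1_surj : CSurj c1 := fun p => ⟨p (), fun _ => rfl⟩

lemma nash1_iff {B : Set ℂ} {f : ℂ → ℂ} : NashOn c1 B f ↔ AnalyticOnNhd ℂ f B ∧
    ∃ P : ℂ[X][X], P ≠ 0 ∧ ∀ x ∈ B, P.evalEval x (f x) = 0 := by
  have key : ∀ (P : Polynomial (MvPolynomial Unit ℂ)) (x y : ℂ),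
      (P.map (MvPolynomial.uniqueAlgEquiv ℂ Unit).toRingEquiv.toRingHom).evalEval x y =
      (P.map (MvPolynomial.eval (fun i => c1 i x))).eval y := by
    intro P x y
    rw [← map_evalRingHom_eval, Polynomial.map_map]
    congr 2
    apply MvPolynomial.ringHom_ext
    · intro r; simp
    · intro i; simp [c1]
  have inj : Function.Injective (MvPolynomial.uniqueAlgEquiv ℂ Unit).toRingEquiv.toRingHom :=
    (MvPolynomial.uniqueAlgEquiv ℂ Unit).injective
  constructor
  · rintro ⟨h, P, hP, hP2⟩
    refine ⟨h, _, (Polynomial.map_ne_zero_iff inj).2 hP, fun x hx => ?_⟩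
    rw [key, hP2 x hx]
  · rintro ⟨h, P, hP, hP2⟩
    obtain ⟨Q, rfl⟩ := Polynomial.map_surjective
      (MvPolynomial.uniqueAlgEquiv ℂ Unit).toRingEquiv.toRingHom (MvPolynomial.uniqueAlgEquiv ℂ Unit).surjective P
    refine ⟨h, Q, (Polynomial.map_ne_zero_iff inj).1 hP, fun x hx => ?_⟩
    rw [← key, hP2 x hx]

lemma poly_an (p : ℂ[X]) (B : Set ℂ) : AnalyticOnNhd ℂ (fun x => p.eval x) B :=
  fun x _ => p.differentiable.analyticAt x

lemma NashOn.an {E σ : Type*} [NormedAddCommGroup E] [NormedSpace ℂ E] {B : Set E}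
    {c : σ → E →L[ℂ] ℂ} {f : E → ℂ} (h : NashOn c B f) : AnalyticOnNhd ℂ f B := h.1

lemma no_log_disc {B : Set ℂ} (hBo : IsOpen B) (hB : IsPreconnected B) (x0 : ℂ) (hx0 : x0 ∈ B)
    {S R : ℂ → ℂ} (hS : NashOn c1 B S) (hR : NashOn c1 B R) (hS0 : S x0 ≠ 0) (hR0 : R x0 ≠ 0)
    (a b : ℂ) (h : ∀ x ∈ B, S x * R x = a * (deriv S x * R x) + b * (deriv R x * S x)) : False := by
  have := hol_isDomain hBo hB ⟨x0, hx0⟩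
  let z : hol B := holMk B (fun x => x) analyticOnNhd_id
  let _ : Algebra ℂ[X] (hol B) := (aeval z).toRingHom.toAlgebra
  have halg : ∀ p : ℂ[X], algebraMap ℂ[X] (hol B) p = holMk B (fun x => p.eval x)
      (poly_an p B) := by
    intro p
    change aeval z p = _
    refine hol_ext fun x hx => ?_
    rw [holEv_mk, ← Polynomial.aeval_algHom_apply]
    change aeval x p = _
    simp
  have hF : FaithfulSMul ℂ[X] (hol B) := by
    rw [faithfulSMul_iff_algebraMap_injective, injective_iff_map_eq_zero]
    intro p hp
    rw [halg] at hp
    have h0 : ∀ x ∈ B, p.eval x = 0 := fun x hx => by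
      have := congrArg (holEv x hx) hp
      simpa using this
    by_contra hne
    have hfin := (p.rootSet_finite ℂ)
    refine (infinite_of_mem_nhds x0 (hBo.mem_nhds hx0)) (hfin.subset fun x hx => ?_)
    rw [mem_rootSet]
    exact ⟨hne, by simpa using h0 x hx⟩
  have hN : ∀ {f : ℂ → ℂ} (hf : NashOn c1 B f), IsAlgebraic ℂ[X] (holMk B f hf.an) := by
    intro f hf
    obtain ⟨-, P, hP, hP2⟩ := nash1_iff.1 hf
    refine ⟨P, hP, hol_ext fun x hx => ?_⟩
    rw [map_zero, ← hP2 x hx, ← map_evalRingHom_eval, Polynomial.eval_map, aeval_def]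
    change (holEv x hx).toRingHom _ = _
    rw [Polynomial.hom_eval₂]
    congr 1
    ext r
    · change holEv x hx (algebraMap ℂ[X] (hol B) (C r)) = _
      rw [halg]; simp
    · change holEv x hx (algebraMap ℂ[X] (hol B) X) = _
      rw [halg]; simp
  refine no_log (holD hBo (1:ℂ)) ?_ (holMk B S hS.an) (holMk B R hR.an) ?_ ?_ (hN hS) (hN hR) a b ?_
  · intro p
    rw [halg, halg]
    erw [holD_mk]
    rw [holMk_eq_iff]
    intro x hx
    simp
  · intro h0
    have := congrArg (holEv x0 hx0) h0
    exact hS0 (by simpa using this)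
  · intro h0
    have := congrArg (holEv x0 hx0) h0
    exact hR0 (by simpa using this)
  · refine hol_ext fun x hx => ?_
    erw [holD_mk, holD_mk]
    rw [halg, halg]
    simp only [map_mul, map_add, holEv_mk, eval_C, fderiv_apply_one_eq_deriv]
    exact h x hx

lemma one_var {B : Set ℂ} (hBo : IsOpen B) 
    {T S R : ℂ → ℂ} (hT : NashOn c1 B T) (hS : NashOn c1 B S) (hR : NashOn c1 B R)
    (hS0 : ∀ x ∈ B, S x ≠ 0) (hR0 : ∀ x ∈ B, R x ≠ 0)
    (a b : ℂ) (h : ∀ x ∈ B, deriv T x = a * (deriv S x / S x) + b * (deriv R x / R x)) :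
    ∀ x ∈ B, deriv T x = 0 := by
  intro x hx
  by_contra hne
  have hTx := hT.1 x hx
  set e := hTx.hasStrictDerivAt.localInverse _ _ _ hne with he
  have hea : AnalyticAt ℂ e (T x) := hTx.analyticAt_localInverse hne
  have hex : e (T x) = x := HasStrictFDerivAt.localInverse_apply_image ..
  have her : ∀ᶠ τ in 𝓝 (T x), T (e τ) = τ :=
    (hTx.hasStrictDerivAt.hasStrictFDerivAt_equiv hne).eventually_right_inverse
  have heB : ∀ᶠ τ in 𝓝 (T x), e τ ∈ B := 
    hea.continuousAt.eventually_mem (by rw [hex]; exact hBo.mem_nhds hx)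
  obtain ⟨r, hr, hball⟩ := Metric.eventually_nhds_iff_ball.1 (her.and (heB.and hea.eventually_analyticAt))
  set B' := Metric.ball (T x) r
  have hB'o : IsOpen B' := Metric.isOpen_ball
  have hB'c : IsPreconnected B' := (convex_ball _ _).isPreconnected
  have hea' : AnalyticOnNhd ℂ e B' := fun τ hτ => (hball τ hτ).2.2
  have heN : NashOn c1 B' e := by
    obtain ⟨-, P, hP, hP2⟩ := nash1_iff.1 hT
    refine nash1_iff.2 ⟨hea', Bivariate.swap P, by simpa using hP, fun τ hτ => ?_⟩
    have h1 := hP2 (e τ) (hball τ hτ).2.1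
    rw [(hball τ hτ).1] at h1
    rw [← coe_aevalAeval_eq_evalEval, Bivariate.aevalAeval_swap, coe_aevalAeval_eq_evalEval]
    exact h1
  have hmem : T x ∈ B' := Metric.mem_ball_self hr
  have hm : ∀ τ ∈ B', e τ ∈ B := fun τ hτ => (hball τ hτ).2.1
  have hSN := NashOn.comp c1_surj hBo hB'o hB'c hS hm hea' (fun _ => heN)
  have hRN := NashOn.comp c1_surj hBo hB'o hB'c hR hm hea' (fun _ => heN)
  refine no_log_disc hB'o hB'c (T x) hmem hSN hRN (hS0 _ (hm _ hmem)) (hR0 _ (hm _ hmem)) a b ?_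
  intro τ hτ
  have hd : ∀ {f : ℂ → ℂ}, AnalyticOnNhd ℂ f B → deriv (fun y => f (e y)) τ = deriv f (e τ) * deriv e τ := by
    intro f hf
    exact deriv_comp τ (hf _ (hm τ hτ)).differentiableAt (hea' τ hτ).differentiableAt
  have h1 : deriv T (e τ) * deriv e τ = 1 := by
    rw [← hd hT.1]
    have : (fun y => T (e y)) =ᶠ[𝓝 τ] fun y => y := by
      filter_upwards [hB'o.mem_nhds hτ] with y hy using (hball y hy).1
    rw [this.deriv_eq]; simp
  rw [hd hS.1, hd hR.1]
  rw [h _ (hm τ hτ)] at h1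
  have e1 := hS0 _ (hm τ hτ)
  have e2 := hR0 _ (hm τ hτ)
  field_simp at h1
  linear_combination -h1

end PB4

section PC1

open Polynomial Topology

lemma sep_poly {R A : Type*} [CommRing R] [IsDomain R] [CharZero R] [CommRing A] 
    (φ : R →+* A) (hinj : Function.Injective φ) (a : A)
    (h : ∃ P : R[X], P ≠ 0 ∧ P.eval₂ φ a = 0) :
    ∃ P : R[X], P.eval₂ φ a = 0 ∧ (derivative P).eval₂ φ a ≠ 0 ∧ P ≠ 0 := by
  classical
  have hex : ∃ n, ∃ P : R[X], P ≠ 0 ∧ P.eval₂ φ a = 0 ∧ P.natDegree = n := by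
    obtain ⟨P, h1, h2⟩ := h
    exact ⟨_, P, h1, h2, rfl⟩
  obtain ⟨P, h1, h2, h3⟩ := Nat.find_spec hex
  have hne : P.natDegree ≠ 0 := by
    intro h0
    rw [natDegree_eq_zero] at h0
    obtain ⟨c, rfl⟩ := h0
    rw [eval₂_C] at h2
    exact h1 (by rw [hinj (h2.trans (map_zero _).symm), map_zero])
  refine ⟨P, h2, ?_, h1⟩
  intro h0
  have hd0 : derivative P ≠ 0 := by
    intro h
    exact hne (derivative_eq_zero.1 h)
  refine Nat.find_min hex (m := (derivative P).natDegree) ?_ ⟨_, hd0, h0, rfl⟩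
  rw [← h3]
  exact natDegree_derivative_lt hne

lemma exists_tb {A : Type*} [CommRing A] [IsDomain A] [Algebra ℂ A] {ι : Type*} [Finite ι]
    (g : ι → A) : ∃ I : Set ι,
      Function.Injective (MvPolynomial.aeval (fun i : I => g i) : MvPolynomial I ℂ →ₐ[ℂ] A) ∧
      ∀ j, ∃ P : Polynomial (MvPolynomial I ℂ),
        P.eval₂ (MvPolynomial.aeval (fun i : I => g i) : MvPolynomial I ℂ →ₐ[ℂ] A).toRingHom (g j) = 0 ∧
        (derivative P).eval₂ (MvPolynomial.aeval (fun i : I => g i) : MvPolynomial I ℂ →ₐ[ℂ] A).toRingHom (g j) ≠ 0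
        ∧ P ≠ 0 := by
  obtain ⟨I, hI, hmax⟩ := (Set.toFinite {I : Set ι | AlgebraicIndepOn ℂ g I}).exists_maximal
    ⟨∅, by
      have : AlgebraicIndepOn ℂ g ∅ := by
        apply algebraicIndependent_empty_type_iff.2
        exact FaithfulSMul.algebraMap_injective ℂ A
      exact this⟩
  have hinj : Function.Injective (MvPolynomial.aeval (fun i : I => g i) : MvPolynomial I ℂ →ₐ[ℂ] A) := hI
  refine ⟨I, hinj, fun j => ?_⟩
  apply sep_poly _ hinj
  by_contra hno
  push Not at hno
  have hI' : AlgebraicIndependent ℂ (fun i : I => g i) := hI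
  have hj : j ∉ I := by
    intro hj
    refine hno (X - C (MvPolynomial.X ⟨j, hj⟩)) (X_sub_C_ne_zero _) ?_
    simp
  have : AlgebraicIndepOn ℂ g (insert j I) := by
    refine AlgebraicIndepOn.insert hI ?_
    rw [Set.image_eq_range, transcendental_iff]
    intro p hp
    obtain ⟨q, rfl⟩ := Polynomial.map_surjective hI'.aevalEquiv.toRingHom hI'.aevalEquiv.surjective p
    rw [Polynomial.aeval_def, Polynomial.eval₂_map] at hp
    by_contra hne
    refine hno q (fun h => hne (by simp [h])) ?_
    have he : (MvPolynomial.aeval (fun i : I => g i) : MvPolynomial I ℂ →ₐ[ℂ] A).toRingHom =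
        (algebraMap (↥(Algebra.adjoin ℂ (Set.range fun x : I => g ↑x))) A).comp
          hI'.aevalEquiv.toRingEquiv.toRingHom := by
      apply RingHom.ext
      intro x
      exact (hI'.algebraMap_aevalEquiv x).symm
    rw [he]
    exact hp
  exact hj (hmax this (Set.subset_insert _ _) (Set.mem_insert _ _))

end PC1

section PC2

open Polynomial Topology
open scoped ContDiff

noncomputable def cpi (ι : Type*) [Fintype ι] : ι → (ι → ℂ) →L[ℂ] ℂ := fun i => ContinuousLinearMap.proj i

lemma cpi_surj (ι : Type*) [Fintype ι] : CSurj (cpi ι) := fun p => ⟨p, fun _ => rfl⟩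

lemma imp_nash {I : Type*} [Fintype I] (P : Polynomial (MvPolynomial I ℂ)) 
    (x1 : I → ℂ) (y1 : ℂ) (h0 : (P.map (MvPolynomial.eval x1)).eval y1 = 0)
    (h1 : ((derivative P).map (MvPolynomial.eval x1)).eval y1 ≠ 0) :
    ∃ ψ : (I → ℂ) → ℂ, AnalyticAt ℂ ψ x1 ∧ ψ x1 = y1 ∧
      (∀ᶠ x in 𝓝 x1, (P.map (MvPolynomial.eval x)).eval (ψ x) = 0) ∧
      (∀ᶠ v in 𝓝 (x1, y1), (P.map (MvPolynomial.eval v.1)).eval v.2 = 0 → ψ v.1 = v.2) := by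
  set f : (I → ℂ) × ℂ → ℂ := fun v => (P.map (MvPolynomial.eval v.1)).eval v.2 with hf
  have hfa : ∀ v, AnalyticAt ℂ f v := by
    intro v
    have : f = fun v => ∑ n ∈ Finset.range (P.natDegree + 1), MvPolynomial.eval v.1 (P.coeff n) * v.2 ^ n := by
      funext v
      simp only [hf]
      rw [Polynomial.eval_map, Polynomial.eval₂_eq_sum_range]
    rw [this]
    apply Finset.analyticAt_fun_sum
    intro n _
    refine AnalyticAt.mul ?_ (analyticAt_snd.pow n)
    exact (analytic_coord_eval (cpi I) (P.coeff n) v.1 trivial).comp analyticAt_fst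
  have cdf : ContDiffAt ℂ ω f (x1, y1) := (hfa _).contDiffAt
  have hd : (fderiv ℂ f (x1, y1) ∘L .inr ℂ (I → ℂ) ℂ) =
      ContinuousLinearMap.toSpanSingleton ℂ (((derivative P).map (MvPolynomial.eval x1)).eval y1) := by
    have e1 : HasFDerivAt (fun y : ℂ => f (x1, y)) (fderiv ℂ f (x1, y1) ∘L .inr ℂ (I → ℂ) ℂ) y1 := by
      have := (hfa (x1,y1)).differentiableAt.hasFDerivAt
      exact this.comp y1 (hasFDerivAt_prodMk_right (𝕜 := ℂ) x1 y1)
    have e2 : HasDerivAt (fun y : ℂ => f (x1, y)) (((derivative P).map (MvPolynomial.eval x1)).eval y1) y1 := by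
      rw [← Polynomial.derivative_map]
      exact Polynomial.hasDerivAt (P.map (MvPolynomial.eval x1)) y1
    exact e1.unique e2.hasFDerivAt
  have if₂ : (fderiv ℂ f (x1, y1) ∘L .inr ℂ (I → ℂ) ℂ).IsInvertible := by
    rw [hd]
    refine ⟨ContinuousLinearEquiv.smulLeft (Units.mk0 _ h1), ?_⟩
    ext
    simp
  have pn : (ω : ℕ∞ω) ≠ 0 := by simp
  refine ⟨cdf.implicitFunction pn if₂, ?_, cdf.implicitFunction_apply_self pn if₂, ?_, ?_⟩
  · exact (cdf.contDiffAt_implicitFunction pn if₂).analyticAt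
  · have := cdf.eventually_apply_implicitFunction pn if₂
    simp only [hf, h0] at this
    exact this
  · have := cdf.eventually_apply_eq_iff_implicitFunction pn if₂
    simp only [hf, h0] at this
    filter_upwards [this] with v hv h
    exact hv.1 h

end PC2

section PC3

open Polynomial Topology
open scoped ContDiff

lemma holEv_aevalG {E : Type*} [NormedAddCommGroup E] [NormedSpace ℂ E] {B : Set E} {I : Type*}
    (g : I → hol B) (x : E) (hx : x ∈ B) (p : MvPolynomial I ℂ) :
    holEv x hx (MvPolynomial.aeval g p) = MvPolynomial.eval (fun i => holEv x hx (g i)) p := by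
  have : (holEv x hx).comp (MvPolynomial.aeval g) = MvPolynomial.aeval (fun i => holEv x hx (g i)) := by
    ext i
    simp only [AlgHom.comp_apply, MvPolynomial.aeval_X]
  have := DFunLike.congr_fun this p
  simpa [MvPolynomial.aeval_eq_eval] using this

lemma holEv_eval2G {E : Type*} [NormedAddCommGroup E] [NormedSpace ℂ E] {B : Set E} {I : Type*}
    (g : I → hol B) (a : hol B) (x : E) (hx : x ∈ B) (P : Polynomial (MvPolynomial I ℂ)) :
    holEv x hx (P.eval₂ (MvPolynomial.aeval g : MvPolynomial I ℂ →ₐ[ℂ] hol B).toRingHom a) =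
      (P.map (MvPolynomial.eval (fun i => holEv x hx (g i)))).eval (holEv x hx a) := by
  rw [show holEv x hx (P.eval₂ (MvPolynomial.aeval g : MvPolynomial I ℂ →ₐ[ℂ] hol B).toRingHom a) =
    (holEv x hx).toRingHom (P.eval₂ (MvPolynomial.aeval g : MvPolynomial I ℂ →ₐ[ℂ] hol B).toRingHom a) from rfl,
    Polynomial.hom_eval₂, Polynomial.eval_map]
  congr 1
  apply RingHom.ext
  intro p
  exact holEv_aevalG g x hx p

theorem alg_curve {m : ℕ} {Δ : Set ℂ} (hΔo : IsOpen Δ) (hΔ : IsPreconnected Δ) (hne : Δ.Nonempty)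
    {G : ℂ → Fin m → ℂ} (hG : AnalyticOnNhd ℂ G Δ) {O1 : Set (Fin m → ℂ)} (hO : IsOpen O1)
    (hGO : ∀ s ∈ Δ, G s ∈ O1) :
    ∃ s1 ∈ Δ, ∃ ρ > 0, ∃ γ : ℂ → Fin m → ℂ, AnalyticOnNhd ℂ γ (Metric.ball 0 ρ) ∧
      (∀ ε ∈ Metric.ball 0 ρ, γ ε ∈ O1) ∧ γ 0 = G s1 ∧ deriv γ 0 = deriv G s1 ∧
      (∀ j, NashOn c1 (Metric.ball 0 ρ) (fun ε => γ ε j)) ∧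
      ∀ N, NashOn (cpi (Fin m)) O1 N → (∀ s ∈ Δ, N (G s) = 0) →
        ∀ ε ∈ Metric.ball 0 ρ, N (γ ε) = 0 := by
  classical
  have := hol_isDomain hΔo hΔ hne
  have hGi : ∀ i, AnalyticOnNhd ℂ (fun s => G s i) Δ := fun i s hs =>
    ((ContinuousLinearMap.proj (R := ℂ) (φ := fun _ : Fin m => ℂ) i).analyticAt _).comp (hG s hs)
  obtain ⟨I, hinj, hP⟩ := exists_tb (fun i => holMk Δ (fun s => G s i) (hGi i))
  choose P hP0 hP1 hPn using hP
  obtain ⟨s1, hs1, hs1'⟩ : ∃ s1, ∃ hs1 : s1 ∈ Δ, holEv s1 hs1 (∏ j, (derivative (P j)).eval₂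
     (MvPolynomial.aeval (fun i : I => holMk Δ (fun s => G s i) (hGi i)) :
      MvPolynomial I ℂ →ₐ[ℂ] hol Δ).toRingHom (holMk Δ (fun s => G s j) (hGi j))) ≠ 0 := by
    by_contra hno
    push Not at hno
    refine (Finset.prod_ne_zero_iff (s := Finset.univ).2 fun j _ => hP1 j) (hol_ext fun x hx => ?_)
    rw [hno, map_zero]
  rw [map_prod] at hs1'
  have hs2 := Finset.prod_ne_zero_iff.1 hs1'
  set GI : ℂ → I → ℂ := fun s i => G s i with hGI
  have hGIa : AnalyticOnNhd ℂ GI Δ := AnalyticOnNhd.pi fun i => hGi i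
  set x1 := GI s1 with hx1
  have hψ : ∀ j, ∃ ψ : (I → ℂ) → ℂ, AnalyticAt ℂ ψ x1 ∧ ψ x1 = G s1 j ∧
      (∀ᶠ x in 𝓝 x1, ((P j).map (MvPolynomial.eval x)).eval (ψ x) = 0) ∧
      (∀ᶠ v in 𝓝 (x1, G s1 j), ((P j).map (MvPolynomial.eval v.1)).eval v.2 = 0 → ψ v.1 = v.2) := by
    intro j
    apply imp_nash
    · have := congrArg (holEv s1 hs1) (hP0 j)
      rw [holEv_eval2G, map_zero] at this
      exact this
    · have := hs2 j (Finset.mem_univ _)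
      rw [holEv_eval2G] at this
      exact this
  choose ψ hψa hψ1 hψ2 hψ3 using hψ
  set Ψ : (I → ℂ) → Fin m → ℂ := fun x j => ψ j x with hΨ
  have hΨ1 : Ψ x1 = G s1 := funext hψ1
  have hΨa : AnalyticAt ℂ Ψ x1 := AnalyticAt.pi hψa
  have ev1 : ∀ᶠ x in 𝓝 x1, (∀ j, AnalyticAt ℂ (ψ j) x) ∧
      (∀ j, ((P j).map (MvPolynomial.eval x)).eval (ψ j x) = 0) ∧ Ψ x ∈ O1 := by
    refine Filter.Eventually.and (Filter.eventually_all.2 fun j => (hψa j).eventually_analyticAt)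
      (Filter.Eventually.and (Filter.eventually_all.2 hψ2) ?_)
    exact hΨa.continuousAt.eventually_mem (hO.mem_nhds (by rw [hΨ1]; exact hGO s1 hs1))
  obtain ⟨r, hr, hB⟩ := Metric.eventually_nhds_iff_ball.1 ev1
  set B := Metric.ball x1 r with hBdef
  have hBo : IsOpen B := Metric.isOpen_ball
  have hBc : IsPreconnected B := (convex_ball x1 r).isPreconnected
  have hx1B : x1 ∈ B := Metric.mem_ball_self hr
  have hψN : ∀ j, NashOn (cpi I) B (ψ j) := fun j =>
    ⟨fun x hx => (hB x hx).1 j, P j, hPn j, fun x hx => (hB x hx).2.1 j⟩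
  have hΨaB : AnalyticOnNhd ℂ Ψ B := AnalyticOnNhd.pi fun j => (hψN j).an
  have hGIc : ContinuousAt GI s1 := (hGIa s1 hs1).continuousAt
  have ev2 : ∀ᶠ s in 𝓝 s1, s ∈ Δ ∧ GI s ∈ B ∧ Ψ (GI s) = G s := by
    refine Filter.Eventually.and (hΔo.mem_nhds hs1) ((hGIc.eventually_mem (hBo.mem_nhds hx1B)).and ?_)
    have : ∀ j, ∀ᶠ s in 𝓝 s1, ψ j (GI s) = G s j := by
      intro j
      have hc : ContinuousAt (fun s => (GI s, G s j)) s1 := hGIc.prodMk (hGi j s1 hs1).continuousAt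
      filter_upwards [hc.eventually (hψ3 j), hΔo.mem_nhds hs1] with s hs hsΔ
      apply hs
      have := congrArg (holEv s hsΔ) (hP0 j)
      rw [holEv_eval2G, map_zero] at this
      exact this
    filter_upwards [Filter.eventually_all.2 this] with s hs
    exact funext hs
  set v := deriv GI s1 with hv
  have hqa : ∀ ε, AnalyticAt ℂ (fun ε : ℂ => x1 + ε • v) ε := fun ε =>
    analyticAt_const.add (analyticAt_id.smul analyticAt_const)
  obtain ⟨ρ, hρ, hρB⟩ : ∃ ρ > 0, ∀ ε ∈ Metric.ball (0:ℂ) ρ, x1 + ε • v ∈ B := by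
    have : ∀ᶠ ε in 𝓝 (0:ℂ), x1 + ε • v ∈ B := by
      apply (hqa 0).continuousAt.eventually_mem
      apply hBo.mem_nhds
      simpa using hx1B
    exact Metric.eventually_nhds_iff_ball.1 this
  have hbo : IsOpen (Metric.ball (0:ℂ) ρ) := Metric.isOpen_ball
  have hbc : IsPreconnected (Metric.ball (0:ℂ) ρ) := (convex_ball (0:ℂ) ρ).isPreconnected
  refine ⟨s1, hs1, ρ, hρ, fun ε => Ψ (x1 + ε • v), ?_, ?_, ?_, ?_, ?_, ?_⟩
  · intro ε hε
    exact AnalyticAt.fun_comp (f := fun ε : ℂ => x1 + ε • v) (hΨaB _ (hρB ε hε)) (hqa ε)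
  · intro ε hε
    exact (hB _ (hρB ε hε)).2.2
  · simp [hΨ1]
  · have d1 : HasDerivAt (fun ε : ℂ => Ψ (x1 + ε • v)) (fderiv ℂ Ψ x1 v) 0 := by
      have h1 : HasDerivAt (fun ε : ℂ => x1 + ε • v) v 0 := by
        simpa using ((hasDerivAt_id (0:ℂ)).smul_const v).const_add x1
      have h2 : HasFDerivAt Ψ (fderiv ℂ Ψ x1) (x1 + (0:ℂ) • v) := by
        simpa using hΨa.differentiableAt.hasFDerivAt
      exact h2.comp_hasDerivAt 0 h1
    have d2 : HasDerivAt (fun s => Ψ (GI s)) (fderiv ℂ Ψ x1 v) s1 :=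
      (show HasFDerivAt Ψ (fderiv ℂ Ψ x1) (GI s1) from
        hΨa.differentiableAt.hasFDerivAt).comp_hasDerivAt s1
        (hGIa s1 hs1).differentiableAt.hasDerivAt
    have d3 : HasDerivAt G (fderiv ℂ Ψ x1 v) s1 := by
      refine d2.congr_of_eventuallyEq ?_
      filter_upwards [ev2] with s hs
      exact hs.2.2.symm
    rw [d1.deriv, d3.deriv]
  · intro j
    refine NashOn.comp (cpi_surj I) hBo hbo hbc (hψN j) hρB (fun ε _ => hqa ε) fun i => ?_
    have := (NashOn.const (B := Metric.ball (0:ℂ) ρ) c1 (x1 i)).add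
      ((NashOn.coord c1 ()).mul (NashOn.const c1 (v i)))
    exact this
  · intro N hN hN0 ε hε
    by_contra hne0
    have hNN : NashOn (cpi I) B (fun x => N (Ψ x)) :=
      NashOn.comp (cpi_surj (Fin m)) hO hBo hBc hN (fun x hx => (hB x hx).2.2) hΨaB
        (fun j => hψN j)
    obtain ⟨Q, hQ0, hQ⟩ := hNN.zero_lemma hBo hBc (x1 + ε • v) (hρB ε hε) hne0
    apply hQ0
    apply hinj
    rw [map_zero]
    obtain ⟨F, hF, hFe⟩ := hol_exists (MvPolynomial.aeval (fun i : I => holMk Δ (fun s => G s i) (hGi i)) (Q.coeff 0))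
    have hz : Set.EqOn F 0 Δ := by
      apply hF.eqOn_zero_of_preconnected_of_eventuallyEq_zero hΔ hs1
      filter_upwards [ev2] with s hs
      obtain ⟨hsΔ, hsB, hse⟩ := hs
      have h1 := hQ (GI s) hsB
      rw [hse, hN0 s hsΔ, ← Polynomial.coeff_zero_eq_eval_zero, Polynomial.coeff_map] at h1
      have h2 := congrArg (holEv s hsΔ) hFe
      rw [holEv_aevalG, holEv_mk] at h2
      rw [← h2]
      exact h1
    rw [hFe]
    refine hol_ext fun s hs => ?_
    rw [holEv_mk, map_zero]
    exact hz hs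

end PC3

section PD1

open Polynomial Topology
open scoped ContDiff

lemma mixed_symm {E : Type*} [NormedAddCommGroup E] [NormedSpace ℂ E]
    {L : E × E → ℂ} {γ K : ℂ → E} {ε0 t0 : ℂ}
    (hL : AnalyticAt ℂ L (γ ε0, K t0)) (hγ : DifferentiableAt ℂ γ ε0) (hK : DifferentiableAt ℂ K t0) :
    ∃ d, HasDerivAt (fun t => fderiv ℂ L (γ ε0, K t) (deriv γ ε0, 0)) d t0 ∧
      HasDerivAt (fun ε => fderiv ℂ L (γ ε, K t0) (0, deriv K t0)) d ε0 ∧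
      d = fderiv ℂ (fderiv ℂ L) (γ ε0, K t0) (deriv γ ε0, 0) (0, deriv K t0) := by
  have h2 : HasFDerivAt (fderiv ℂ L) (fderiv ℂ (fderiv ℂ L) (γ ε0, K t0)) (γ ε0, K t0) :=
    hL.fderiv.differentiableAt.hasFDerivAt
  have p1 : HasDerivAt (fun t => (γ ε0, K t)) ((0 : E), deriv K t0) t0 :=
    (hasDerivAt_const t0 (γ ε0)).prodMk hK.hasDerivAt
  have p2 : HasDerivAt (fun ε => (γ ε, K t0)) (deriv γ ε0, (0 : E)) ε0 :=
    hγ.hasDerivAt.prodMk (hasDerivAt_const ε0 (K t0))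
  have hs : IsSymmSndFDerivAt ℂ L (γ ε0, K t0) :=
    (hL.contDiffAt (n := ω)).isSymmSndFDerivAt (by simp)
  have q1 : HasDerivAt (fun t => fderiv ℂ L (γ ε0, K t))
      (fderiv ℂ (fderiv ℂ L) (γ ε0, K t0) (0, deriv K t0)) t0 := h2.comp_hasDerivAt t0 p1
  have q2 : HasDerivAt (fun ε => fderiv ℂ L (γ ε, K t0))
      (fderiv ℂ (fderiv ℂ L) (γ ε0, K t0) (deriv γ ε0, 0)) ε0 := h2.comp_hasDerivAt ε0 p2
  have ap : ∀ (A : ℂ → (E × E →L[ℂ] ℂ)) (A' : E × E →L[ℂ] ℂ) (x : ℂ) (v : E × E),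
      HasDerivAt A A' x → HasDerivAt (fun y => A y v) (A' v) x := by
    intro A A' x v h
    exact (ContinuousLinearMap.apply ℂ ℂ v).hasFDerivAt.comp_hasDerivAt x h
  refine ⟨_, ?_, ap _ _ _ _ q2, rfl⟩
  rw [hs.eq (deriv γ ε0, 0) (0, deriv K t0)]
  exact ap _ _ _ _ q1

noncomputable def cpp (m : ℕ) : Fin m ⊕ Fin m → ((Fin m → ℂ) × (Fin m → ℂ)) →L[ℂ] ℂ :=
  Sum.elim (fun i => (ContinuousLinearMap.proj (R := ℂ) (φ := fun _ : Fin m => ℂ) i).comp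
      (ContinuousLinearMap.fst ℂ (Fin m → ℂ) (Fin m → ℂ)))
    (fun i => (ContinuousLinearMap.proj (R := ℂ) (φ := fun _ : Fin m => ℂ) i).comp
      (ContinuousLinearMap.snd ℂ (Fin m → ℂ) (Fin m → ℂ)))

lemma cpp_surj (m : ℕ) : CSurj (cpp m) := fun p => ⟨(fun i => p (.inl i), fun i => p (.inr i)),
  fun i => by cases i <;> rfl⟩

lemma nash_slice {m : ℕ} {O1 O2 : Set (Fin m → ℂ)} (h1 : IsOpen O1) (h1c : IsPreconnected O1)
    (h2 : IsOpen O2) {D : (Fin m → ℂ) × (Fin m → ℂ) → ℂ} (hD : NashOn (cpp m) (O1 ×ˢ O2) D)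
    {w : Fin m → ℂ} (hw : w ∈ O2) : NashOn (cpi (Fin m)) O1 (fun z => D (z, w)) := by
  refine NashOn.comp (cpp_surj m) (h1.prod h2) h1 h1c hD (q := fun z => (z, w)) (fun z hz => ⟨hz, hw⟩)
    (fun z _ => analyticAt_id.prod analyticAt_const) ?_
  rintro (i | i)
  · exact NashOn.coord (cpi (Fin m)) i
  · exact NashOn.const (cpi (Fin m)) (w i)

lemma span_functionals {n : ℕ} {X : Type*} (S : Set X) (u : X → Fin n → ℂ) :
    ∃ (k : ℕ) (t : Fin k → X) (φ : Fin k → ((Fin n → ℂ) →L[ℂ] ℂ)), (∀ l, t l ∈ S) ∧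
      ∀ x ∈ S, u x = ∑ l, φ l (u x) • u (t l) := by
  classical
  obtain ⟨b, hb1, -, hb2, hb3⟩ := exists_linearIndepOn_extension (K := ℂ) (v := u) (s := (∅ : Set X))
    (t := S) (linearIndepOn_empty ℂ u) (Set.empty_subset _)
  have hbli : LinearIndependent ℂ (fun x : b => u x) := hb3
  have : Finite b := hbli.finite
  let _ : Fintype b := Fintype.ofFinite b
  let e := Fintype.equivFin b
  let Bs := Module.Basis.span hbli
  have hext : ∀ i : b, ∃ g : (Fin n → ℂ) →ₗ[ℂ] ℂ, g ∘ₗ (Submodule.span ℂ (Set.range (fun x : b => u x))).subtype = Bs.coord i :=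
    fun i => LinearMap.exists_extend _
  choose g hg using hext
  refine ⟨Fintype.card b, fun l => (e.symm l : X), fun l => (g (e.symm l)).toContinuousLinearMap, 
    fun l => hb1 (e.symm l).2, fun x hx => ?_⟩
  have hxs : u x ∈ Submodule.span ℂ (Set.range (fun x : b => u x)) := by
    have := hb2 ⟨x, hx, rfl⟩
    rwa [Set.image_eq_range] at this
  have h1 := congrArg Subtype.val (Bs.sum_repr ⟨u x, hxs⟩)
  rw [← e.symm.sum_comp] at h1
  simp only [Submodule.coe_sum, Submodule.coe_smul] at h1
  refine h1.symm.trans (Finset.sum_congr rfl fun l _ => ?_)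
  have h2 := LinearMap.congr_fun (hg (e.symm l)) ⟨u x, hxs⟩
  simp only [LinearMap.comp_apply, Submodule.subtype_apply] at h2
  rw [LinearMap.coe_toContinuousLinearMap', h2]
  congr 1
  exact congrArg Subtype.val (Module.Basis.span_apply hbli (e.symm l))

end PD1

section PD2

open Polynomial Topology
open scoped ContDiff

lemma const_of_hasDerivAt {S : Set ℂ} (hSo : IsOpen S) (hS : IsPreconnected S) {q : ℂ → ℂ}
    (h : ∀ x ∈ S, HasDerivAt q 0 x) {x y : ℂ} (hx : x ∈ S) (hy : y ∈ S) : q x = q y :=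
  hSo.is_const_of_deriv_eq_zero hS (fun x hx => (h x hx).differentiableAt.differentiableWithinAt)
    (fun x hx => (h x hx).deriv) hx hy

theorem core {m n : ℕ} {Δ Δ' : Set ℂ} (hΔo : IsOpen Δ) (hΔ : IsPreconnected Δ) (hne : Δ.Nonempty)
    (hΔo' : IsOpen Δ') (hΔ' : IsPreconnected Δ') (hne' : Δ'.Nonempty)
    {O1 O2 : Set (Fin m → ℂ)} (h1 : IsOpen O1) (h1c : IsPreconnected O1)
    (h2 : IsOpen O2) (h2c : IsPreconnected O2)
    {D Φ L : (Fin m → ℂ) × (Fin m → ℂ) → ℂ}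
    (hD : NashOn (cpp m) (O1 ×ˢ O2) D) (hΦ : NashOn (cpp m) (O1 ×ˢ O2) Φ)
    (hD0 : ∀ p ∈ O1 ×ˢ O2, D p ≠ 0) (hΦ0 : ∀ p ∈ O1 ×ˢ O2, Φ p ≠ 0)
    (hL : AnalyticOnNhd ℂ L (O1 ×ˢ O2)) (a b : ℂ)
    (hL' : ∀ p ∈ O1 ×ˢ O2, ∀ v, fderiv ℂ L p v =
      a * (fderiv ℂ D p v / D p) + b * (fderiv ℂ Φ p v / Φ p))
    {G K : ℂ → Fin m → ℂ} (hG : AnalyticOnNhd ℂ G Δ) (hK : AnalyticOnNhd ℂ K Δ')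
    (hGO : ∀ s ∈ Δ, G s ∈ O1) (hKO : ∀ t ∈ Δ', K t ∈ O2)
    {f h : Fin n → ℂ → ℂ} (hf : ∀ j, DifferentiableOn ℂ (f j) Δ)
    (hh : ∀ j, DifferentiableOn ℂ (h j) Δ')
    (heq : ∀ s ∈ Δ, ∀ t ∈ Δ', ∑ j, deriv (f j) s * deriv (h j) t =
      fderiv ℂ (fderiv ℂ L) (G s, K t) (deriv G s, 0) (0, deriv K t)) :
    ∃ s1 ∈ Δ, ∀ t ∈ Δ', ∑ j, deriv (f j) s1 * deriv (h j) t = 0 := by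
  classical
  obtain ⟨s1, hs1, ρ, hρ, γ, hγa, hγO, hγ0, hγ1, hγN, hγZ⟩ := alg_curve hΔo hΔ hne hG h1 hGO
  have hOo : IsOpen (O1 ×ˢ O2) := h1.prod h2
  have hOc : IsPreconnected (O1 ×ˢ O2) := h1c.prod h2c
  have hf' : ∀ j, ∀ s ∈ Δ, HasDerivAt (f j) (deriv (f j) s) s := fun j s hs =>
    ((hf j).differentiableAt (hΔo.mem_nhds hs)).hasDerivAt
  have hh' : ∀ j, ∀ s ∈ Δ', HasDerivAt (h j) (deriv (h j) s) s := fun j s hs =>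
    ((hh j).differentiableAt (hΔo'.mem_nhds hs)).hasDerivAt
  have hbo : IsOpen (Metric.ball (0:ℂ) ρ) := Metric.isOpen_ball
  have hbc : IsPreconnected (Metric.ball (0:ℂ) ρ) := (convex_ball (0:ℂ) ρ).isPreconnected
  have h0ρ : (0:ℂ) ∈ Metric.ball (0:ℂ) ρ := Metric.mem_ball_self hρ
  -- the function b
  set bb : ℂ → (Fin m → ℂ) → ℂ := fun t z => fderiv ℂ L (z, K t) (0, deriv K t) with hbb
  have hbN : ∀ t ∈ Δ', NashOn (cpi (Fin m)) O1 (bb t) := by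
    intro t ht
    have e1 := nash_slice h1 h1c h2 (nash_fderiv (cpp_surj m) hOo hOc hD (0, deriv K t)) (hKO t ht)
    have e2 := (nash_slice h1 h1c h2 hD (hKO t ht)).inv (fun z hz => hD0 _ ⟨hz, hKO t ht⟩)
    have e3 := nash_slice h1 h1c h2 (nash_fderiv (cpp_surj m) hOo hOc hΦ (0, deriv K t)) (hKO t ht)
    have e4 := (nash_slice h1 h1c h2 hΦ (hKO t ht)).inv (fun z hz => hΦ0 _ ⟨hz, hKO t ht⟩)
    have e5 := ((NashOn.const (cpi (Fin m)) a).mul (e1.mul e2)).add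
      ((NashOn.const (cpi (Fin m)) b).mul (e3.mul e4))
    refine e5.congr h1 fun z hz => ?_
    simp only [hbb]
    rw [hL' _ ⟨hz, hKO t ht⟩]
    simp only [div_eq_mul_inv]
  obtain ⟨s0, hs0⟩ := hne
  -- step 1
  have st1 : ∀ t ∈ Δ', ∀ s ∈ Δ, ∑ j, (f j s - f j s0) * deriv (h j) t = bb t (G s) - bb t (G s0) := by
    intro t ht s hs
    have : ∀ x ∈ Δ, HasDerivAt (fun s => ∑ j, f j s * deriv (h j) t - bb t (G s)) 0 x := by
      intro x hx
      obtain ⟨d, -, hd2, hd3⟩ := mixed_symm (hL (G x, K t) ⟨hGO x hx, hKO t ht⟩)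
        (hG x hx).differentiableAt (hK t ht).differentiableAt
      have e1 : HasDerivAt (fun s => ∑ j, f j s * deriv (h j) t) (∑ j, deriv (f j) x * deriv (h j) t) x :=
        HasDerivAt.fun_sum fun j _ => (hf' j x hx).mul_const _
      have e2 := e1.sub hd2
      rw [hd3, ← heq x hx t ht, sub_self] at e2
      exact e2
    have := const_of_hasDerivAt hΔo hΔ this hs hs0
    simp only [sub_mul, Finset.sum_sub_distrib]
    linear_combination this
  -- step 2
  obtain ⟨k, tl, φ, htl, hφ⟩ := span_functionals Δ' (fun t => fun j => deriv (h j) t)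
  have hφj : ∀ t ∈ Δ', ∀ j, deriv (h j) t = ∑ l, φ l (fun j => deriv (h j) t) * deriv (h j) (tl l) := by
    intro t ht j
    have := congrFun (hφ t ht) j
    simpa using this
  -- step 3
  have st3 : ∀ t ∈ Δ', ∃ C, ∀ ε ∈ Metric.ball (0:ℂ) ρ,
      bb t (γ ε) = ∑ l, φ l (fun j => deriv (h j) t) * bb (tl l) (γ ε) + C := by
    intro t ht
    set C := bb t (G s0) - ∑ l, φ l (fun j => deriv (h j) t) * bb (tl l) (G s0) with hC
    refine ⟨C, fun ε hε => ?_⟩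
    have hN := hγZ (fun z => bb t z - (∑ l, φ l (fun j => deriv (h j) t) * bb (tl l) z + C))
      ((hbN t ht).sub ((NashOn.sum Finset.univ fun l _ =>
        (NashOn.const _ _).mul (hbN (tl l) (htl l))).add (NashOn.const _ _))) ?_ ε hε
    · exact sub_eq_zero.1 hN
    · intro s hs
      have e0 := st1 t ht s hs
      have e1 : ∑ l, φ l (fun j => deriv (h j) t) * (bb (tl l) (G s) - bb (tl l) (G s0)) =
          ∑ j, (f j s - f j s0) * deriv (h j) t := by
        simp_rw [← fun l => st1 (tl l) (htl l) s hs, Finset.mul_sum]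
        rw [Finset.sum_comm]
        refine Finset.sum_congr rfl fun j _ => ?_
        conv_rhs => rw [hφj t ht j]
        rw [Finset.mul_sum]
        exact Finset.sum_congr rfl fun l _ => by ring
      simp only [mul_sub, Finset.sum_sub_distrib] at e1
      simp only [hC]
      linear_combination -e0 - e1
  -- derivative of b along γ
  have hbd : ∀ t ∈ Δ', ∀ ε ∈ Metric.ball (0:ℂ) ρ,
      HasDerivAt (fun ε => bb t (γ ε)) (deriv (fun ε => bb t (γ ε)) ε) ε := by
    intro t ht ε hε
    exact ((hbN t ht).an _ (hγO ε hε)).differentiableAt.comp ε (hγa ε hε).differentiableAt |>.hasDerivAt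
  have hΛ : ∀ t ∈ Δ', ∀ ε ∈ Metric.ball (0:ℂ) ρ,
      HasDerivAt (fun t => fderiv ℂ L (γ ε, K t) (deriv γ ε, 0)) (deriv (fun ε => bb t (γ ε)) ε) t := by
    intro t ht ε hε
    obtain ⟨d, hd1, hd2, hd3⟩ := mixed_symm (hL (γ ε, K t) ⟨hγO ε hε, hKO t ht⟩)
        (hγa ε hε).differentiableAt (hK t ht).differentiableAt
    have : deriv (fun ε => bb t (γ ε)) ε = d := hd2.deriv
    rw [this]
    exact hd1
  have st4 : ∀ t ∈ Δ', ∀ ε ∈ Metric.ball (0:ℂ) ρ, deriv (fun ε => bb t (γ ε)) ε =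
      ∑ l, φ l (fun j => deriv (h j) t) * deriv (fun ε => bb (tl l) (γ ε)) ε := by
    intro t ht ε hε
    obtain ⟨C, hC⟩ := st3 t ht
    have e1 : HasDerivAt (fun ε => ∑ l, φ l (fun j => deriv (h j) t) * bb (tl l) (γ ε) + C)
        (∑ l, φ l (fun j => deriv (h j) t) * deriv (fun ε => bb (tl l) (γ ε)) ε) ε :=
      (HasDerivAt.fun_sum fun l _ => (hbd (tl l) (htl l) ε hε).const_mul _).add_const C
    rw [← e1.deriv]
    apply Filter.EventuallyEq.deriv_eq
    filter_upwards [hbo.mem_nhds hε] with x hx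
    exact hC x hx
  obtain ⟨t0, ht0⟩ := hne'
  have st5 : ∀ t ∈ Δ', ∀ ε ∈ Metric.ball (0:ℂ) ρ,
      ∑ l, φ l (fun j => h j t - h j t0) * deriv (fun ε => bb (tl l) (γ ε)) ε =
      fderiv ℂ L (γ ε, K t) (deriv γ ε, 0) - fderiv ℂ L (γ ε, K t0) (deriv γ ε, 0) := by
    intro t ht ε hε
    have hz : ∀ x ∈ Δ', HasDerivAt (fun t => fderiv ℂ L (γ ε, K t) (deriv γ ε, 0) -
        ∑ l, φ l (fun j => h j t - h j t0) * deriv (fun ε => bb (tl l) (γ ε)) ε) 0 x := by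
      intro x hx
      have e1 : ∀ l, HasDerivAt (fun t => φ l (fun j => h j t - h j t0)) (φ l (fun j => deriv (h j) x)) x := by
        intro l
        refine (φ l).hasFDerivAt.comp_hasDerivAt x (?_ : HasDerivAt (fun t => fun j => h j t - h j t0) _ x)
        exact hasDerivAt_pi.2 fun j => (hh' j x hx).sub_const _
      have e2 : HasDerivAt (fun t => ∑ l, φ l (fun j => h j t - h j t0) * deriv (fun ε => bb (tl l) (γ ε)) ε)
          (∑ l, φ l (fun j => deriv (h j) x) * deriv (fun ε => bb (tl l) (γ ε)) ε) x :=
        HasDerivAt.fun_sum fun l _ => (e1 l).mul_const _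
      have e3 := (hΛ x hx ε hε).sub e2
      rw [st4 x hx ε hε, sub_self] at e3
      exact e3
    have := const_of_hasDerivAt hΔo' hΔ' hz ht ht0
    have hzero : (fun j => h j t0 - h j t0) = (0 : Fin n → ℂ) := by funext j; simp
    simp only [hzero, map_zero, zero_mul, Finset.sum_const_zero, sub_zero] at this
    linear_combination -this
  -- Nash along γ
  have hcomp1 : ∀ {q : (Fin m → ℂ) → ℂ}, NashOn (cpi (Fin m)) O1 q →
      NashOn c1 (Metric.ball (0:ℂ) ρ) (fun ε => q (γ ε)) := fun hq =>
    NashOn.comp (cpi_surj (Fin m)) h1 hbo hbc hq hγO hγa hγN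
  have hld : ∀ {Q : (Fin m → ℂ) × (Fin m → ℂ) → ℂ}, NashOn (cpp m) (O1 ×ˢ O2) Q → ∀ t ∈ Δ',
      ∀ ε ∈ Metric.ball (0:ℂ) ρ,
      HasDerivAt (fun ε => Q (γ ε, K t)) (fderiv ℂ Q (γ ε, K t) (deriv γ ε, 0)) ε := by
    intro Q hQ t ht ε hε
    have e1 := (hQ.an (γ ε, K t) ⟨hγO ε hε, hKO t ht⟩).differentiableAt.hasFDerivAt
    have p2 : HasDerivAt (fun ε => (γ ε, K t)) (deriv γ ε, (0 : Fin m → ℂ)) ε :=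
      (hγa ε hε).differentiableAt.hasDerivAt.prodMk (hasDerivAt_const ε (K t))
    exact e1.comp_hasDerivAt ε p2
  have st6 : ∀ t ∈ Δ', ∀ ε ∈ Metric.ball (0:ℂ) ρ,
      fderiv ℂ L (γ ε, K t) (deriv γ ε, 0) = fderiv ℂ L (γ ε, K t0) (deriv γ ε, 0) := by
    intro t ht ε hε
    have hTd : ∀ ε ∈ Metric.ball (0:ℂ) ρ, HasDerivAt (fun ε => ∑ l, φ l (fun j => h j t - h j t0) * bb (tl l) (γ ε))
        (∑ l, φ l (fun j => h j t - h j t0) * deriv (fun ε => bb (tl l) (γ ε)) ε) ε := fun ε hε =>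
      HasDerivAt.fun_sum fun l _ => (hbd (tl l) (htl l) ε hε).const_mul _
    have hTN : NashOn c1 (Metric.ball (0:ℂ) ρ) (fun ε => ∑ l, φ l (fun j => h j t - h j t0) * bb (tl l) (γ ε)) :=
      NashOn.sum Finset.univ fun l _ => (NashOn.const _ _).mul (hcomp1 (hbN (tl l) (htl l)))
    have hQN : ∀ {Q : (Fin m → ℂ) × (Fin m → ℂ) → ℂ}, NashOn (cpp m) (O1 ×ˢ O2) Q → 
        (∀ p ∈ O1 ×ˢ O2, Q p ≠ 0) →
        NashOn c1 (Metric.ball (0:ℂ) ρ) (fun ε => Q (γ ε, K t) * (Q (γ ε, K t0))⁻¹) := by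
      intro Q hQ hQ0
      exact (hcomp1 (nash_slice h1 h1c h2 hQ (hKO t ht))).mul
        ((hcomp1 (nash_slice h1 h1c h2 hQ (hKO t0 ht0))).inv fun ε hε => hQ0 _ ⟨hγO ε hε, hKO t0 ht0⟩)
    have hQd : ∀ {Q : (Fin m → ℂ) × (Fin m → ℂ) → ℂ}, NashOn (cpp m) (O1 ×ˢ O2) Q → 
        (∀ p ∈ O1 ×ˢ O2, Q p ≠ 0) → ∀ ε ∈ Metric.ball (0:ℂ) ρ,
        deriv (fun ε => Q (γ ε, K t) * (Q (γ ε, K t0))⁻¹) ε / (Q (γ ε, K t) * (Q (γ ε, K t0))⁻¹) =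
        fderiv ℂ Q (γ ε, K t) (deriv γ ε, 0) / Q (γ ε, K t) -
        fderiv ℂ Q (γ ε, K t0) (deriv γ ε, 0) / Q (γ ε, K t0) := by
      intro Q hQ hQ0 ε hε
      have n1 := hQ0 _ (show (γ ε, K t) ∈ O1 ×ˢ O2 from ⟨hγO ε hε, hKO t ht⟩)
      have n2 := hQ0 _ (show (γ ε, K t0) ∈ O1 ×ˢ O2 from ⟨hγO ε hε, hKO t0 ht0⟩)
      rw [((hld hQ t ht ε hε).fun_mul ((hld hQ t0 ht0 ε hε).fun_inv n2)).deriv]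
      field_simp
      ring
    have := one_var hbo hTN (hQN hD hD0) (hQN hΦ hΦ0)
      (fun ε hε => mul_ne_zero (hD0 _ ⟨hγO ε hε, hKO t ht⟩) (inv_ne_zero (hD0 _ ⟨hγO ε hε, hKO t0 ht0⟩)))
      (fun ε hε => mul_ne_zero (hΦ0 _ ⟨hγO ε hε, hKO t ht⟩) (inv_ne_zero (hΦ0 _ ⟨hγO ε hε, hKO t0 ht0⟩)))
      a b (fun ε hε => by
        rw [(hTd ε hε).deriv, st5 t ht ε hε, hQd hD hD0 ε hε, hQd hΦ hΦ0 ε hε,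
          hL' _ ⟨hγO ε hε, hKO t ht⟩, hL' _ ⟨hγO ε hε, hKO t0 ht0⟩]
        ring) ε hε
    rw [(hTd ε hε).deriv, st5 t ht ε hε] at this
    exact sub_eq_zero.1 this
  refine ⟨s1, hs1, fun t ht => ?_⟩
  rw [heq s1 hs1 t ht]
  obtain ⟨d, hd1, hd2, hd3⟩ := mixed_symm (hL (γ 0, K t) ⟨hγO 0 h0ρ, hKO t ht⟩)
        (hγa 0 h0ρ).differentiableAt (hK t ht).differentiableAt
  rw [hγ1, hγ0] at hd3
  rw [← hd3]
  have : HasDerivAt (fun t => fderiv ℂ L (γ 0, K t) (deriv γ 0, 0)) 0 t := by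
    refine (hasDerivAt_const t (fderiv ℂ L (γ 0, K t0) (deriv γ 0, 0))).congr_of_eventuallyEq ?_
    filter_upwards [hΔo'.mem_nhds ht] with x hx
    exact st6 x hx 0 h0ρ
  exact hd1.unique this

end PD2

section PO1

open Topology

/-- Parametrised Osgood property of a normed space. -/
def OsgoodP (E : Type) [NormedAddCommGroup E] [NormedSpace ℂ E] : Prop :=
  ∀ (X : Type) [MetricSpace X] [CompactSpace X] (f : X × E → ℂ) (r : ℝ), 0 < r →
    ContinuousOn f (Set.univ ×ˢ Metric.ball 0 r) →
    (∀ x, DifferentiableOn ℂ (fun e => f (x, e)) (Metric.ball 0 r)) →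
    ∃ g : E → C(X, ℂ), AnalyticAt ℂ g 0 ∧ ∀ᶠ e in 𝓝 (0:E), ∀ x, g e x = f (x, e)

lemma two_pi_nn : (0:ℝ) ≤ 2 * Real.pi := by positivity

noncomputable def osgJ (X : Type) [MetricSpace X] [CompactSpace X] :
    C(X × Set.Icc (0:ℝ) (2 * Real.pi), ℂ) →L[ℂ] C(X, ℂ) :=
  LinearMap.mkContinuous
    { toFun := fun φ => ⟨fun x => ∫ θ in (0:ℝ)..(2 * Real.pi), φ (x, Set.projIcc 0 (2*Real.pi) two_pi_nn θ), by
        apply intervalIntegral.continuous_parametric_intervalIntegral_of_continuous'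
        fun_prop⟩
      map_add' := by
        intro φ ψ
        ext x
        simp only [ContinuousMap.coe_mk, ContinuousMap.add_apply]
        apply intervalIntegral.integral_add <;>
        · apply Continuous.intervalIntegrable
          fun_prop
      map_smul' := by
        intro c φ
        ext x
        simp }
    (2 * Real.pi) (by
      intro φ
      rw [ContinuousMap.norm_le _ (by positivity)]
      intro x
      have := intervalIntegral.norm_integral_le_of_norm_le_const (a := 0) (b := 2*Real.pi)
        (f := fun θ => φ (x, Set.projIcc 0 (2*Real.pi) two_pi_nn θ)) (C := ‖φ‖)
        (fun θ _ => φ.norm_coe_le_norm _)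
      rw [sub_zero, abs_of_nonneg two_pi_nn] at this
      exact this.trans_eq (mul_comm _ _))

lemma osgJ_apply {X : Type} [MetricSpace X] [CompactSpace X]
    (φ : C(X × Set.Icc (0:ℝ) (2 * Real.pi), ℂ)) (x : X) :
    osgJ X φ x = ∫ θ in (0:ℝ)..(2 * Real.pi), φ (x, Set.projIcc 0 (2*Real.pi) two_pi_nn θ) := rfl

lemma osg_zero (E : Type) [NormedAddCommGroup E] [NormedSpace ℂ E] [Subsingleton E] : OsgoodP E := by
  intro X _ _ f r hr hc hd
  have hcc : Continuous fun x => f (x, 0) := by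
    apply hc.comp_continuous (by fun_prop)
    intro x; simp [hr]
  refine ⟨fun _ => ⟨fun x => f (x, 0), hcc⟩, ?_, ?_⟩
  · exact analyticAt_const (v := (⟨fun x => f (x, 0), hcc⟩ : C(X, ℂ)))
  · refine Filter.Eventually.of_forall fun e x => ?_
    rw [Subsingleton.elim e 0]; rfl

lemma osg_equiv {E E' : Type} [NormedAddCommGroup E] [NormedSpace ℂ E]
    [NormedAddCommGroup E'] [NormedSpace ℂ E'] (T : E ≃L[ℂ] E') (h : OsgoodP E) : OsgoodP E' := by
  intro X _ _ f r hr hc hd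
  have : T ⁻¹' Metric.ball 0 r ∈ 𝓝 (0:E) := by
    apply T.continuous.continuousAt.preimage_mem_nhds
    rw [map_zero]; exact Metric.ball_mem_nhds _ hr
  obtain ⟨ρ, hρ, hρs⟩ := Metric.mem_nhds_iff.1 this
  obtain ⟨g, hg, hg'⟩ := h X (fun p => f (p.1, T p.2)) ρ hρ
    (hc.comp (by fun_prop) fun p hp => ⟨trivial, hρs hp.2⟩)
    (fun x => (hd x).comp T.differentiable.differentiableOn hρs)
  refine ⟨fun e => g (T.symm e), ?_, ?_⟩
  · have hg0 : AnalyticAt ℂ g (T.symm 0) := by rwa [map_zero]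
    exact AnalyticAt.comp (f := T.symm) hg0 ((T.symm : E' →L[ℂ] E).analyticAt 0)
  · have : Filter.Tendsto T.symm (𝓝 0) (𝓝 0) := by
      have := T.symm.continuous.tendsto 0
      rwa [map_zero] at this
    filter_upwards [this.eventually hg'] with e he x
    simpa using he x

lemma osg_succ {E : Type} [NormedAddCommGroup E] [NormedSpace ℂ E] (h : OsgoodP E) :
    OsgoodP (ℂ × E) := by
  intro X _ _ f r hr hc hd
  set R := r / 2 with hR
  have hR0 : 0 < R := by positivity
  have hRr : R < r := by linarith
  have hcirc : ∀ θ, ‖circleMap 0 R θ‖ = R := fun θ => by simp [abs_of_pos hR0]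
  obtain ⟨g', hg', hg''⟩ := h (X × Set.Icc (0:ℝ) (2 * Real.pi))
    (fun p => f (p.1.1, (circleMap 0 R p.1.2, p.2))) r hr
    (hc.comp (by fun_prop) fun p hp => ⟨trivial, by
        have := hp.2
        simp only [mem_ball_zero_iff, Prod.norm_mk] at this ⊢
        rw [hcirc]; exact max_lt hRr this⟩)
    (fun x => (hd x.1).comp ((differentiableOn_const (circleMap 0 R x.2)).prodMk (differentiableOn_id (𝕜 := ℂ))) fun e he => by
        simp only [mem_ball_zero_iff, Prod.norm_mk] at he ⊢
        rw [hcirc]; exact max_lt hRr he)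
  let A := C(X × Set.Icc (0:ℝ) (2 * Real.pi), ℂ)
  let ci : A := ⟨fun p => circleMap 0 R p.2, by fun_prop⟩
  let w : A := ⟨fun p => (2 * Real.pi * Complex.I)⁻¹ * (circleMap 0 R p.2 * Complex.I), by fun_prop⟩
  have hunit : IsUnit ci := by
    rw [ContinuousMap.isUnit_iff_forall_ne_zero]
    intro p hp
    have := hcirc p.2
    rw [show circleMap 0 R p.2 = 0 from hp] at this
    simp at this; exact hR0.ne this
  let aff : ℂ → A := fun z => ci - algebraMap ℂ A z
  have haff : AnalyticAt ℂ aff 0 := by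
    apply AnalyticAt.sub analyticAt_const
    exact (Algebra.linearMap ℂ A).toContinuousLinearMap.analyticAt 0
  have haff0 : aff 0 = ci := by simp [aff]
  have hk : AnalyticAt ℂ (fun z => Ring.inverse (aff z)) 0 := by
    obtain ⟨u, hu⟩ := hunit
    have : AnalyticAt ℂ Ring.inverse (aff 0) := by
      rw [haff0, ← hu]; exact analyticAt_inverse u
    exact this.comp haff
  refine ⟨fun p => osgJ X (w * (Ring.inverse (aff p.1) * g' p.2)), ?_, ?_⟩
  · have h1 : AnalyticAt ℂ (fun p : ℂ × E => Ring.inverse (aff p.1)) 0 :=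
      AnalyticAt.comp (g := fun z => Ring.inverse (aff z)) (f := Prod.fst) (x := (0 : ℂ × E)) hk analyticAt_fst
    have h2 : AnalyticAt ℂ (fun p : ℂ × E => g' p.2) 0 :=
      AnalyticAt.comp (g := g') (f := Prod.snd) (x := (0 : ℂ × E)) hg' analyticAt_snd
    exact ((osgJ X).analyticAt _).comp (analyticAt_const.mul (h1.mul h2))
  · have hu1 : ∀ᶠ z in 𝓝 (0:ℂ), IsUnit (aff z) := by
      apply haff.continuousAt.eventually
      rw [haff0]
      exact Units.isOpen.mem_nhds hunit
    have t1 : Filter.Tendsto (Prod.fst : ℂ × E → ℂ) (𝓝 0) (𝓝 0) := continuous_fst.tendsto 0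
    have t2 : Filter.Tendsto (Prod.snd : ℂ × E → E) (𝓝 0) (𝓝 0) := continuous_snd.tendsto 0
    filter_upwards [t1.eventually hu1, t2.eventually hg'', t1.eventually (Metric.ball_mem_nhds _ hR0),
      t2.eventually (Metric.ball_mem_nhds _ hr)] with p hp1 hp2 hp3 hp4 x
    have hinv : ∀ q, (Ring.inverse (aff p.1)) q = (circleMap 0 R q.2 - p.1)⁻¹ := by
      intro q
      have := DFunLike.congr_fun (Ring.mul_inverse_cancel _ hp1) q
      have h2 : (circleMap 0 R q.2 - p.1) * (Ring.inverse (aff p.1)) q = 1 := this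
      exact eq_inv_of_mul_eq_one_right h2
    have hmem : ∀ z ∈ Metric.closedBall (0:ℂ) R, (z, p.2) ∈ Metric.ball (0 : ℂ × E) r := by
      intro z hz
      simp only [mem_ball_zero_iff, mem_closedBall_zero_iff, Prod.norm_mk] at hz hp4 ⊢
      exact max_lt (hz.trans_lt hRr) (by simpa using hp4)
    have hD : DifferentiableOn ℂ (fun z => f (x, (z, p.2))) (Metric.closedBall 0 R) :=
      (hd x).comp (by fun_prop) hmem
    have hC := hD.circleIntegral_sub_inv_smul hp3
    rw [osgJ_apply]
    have : f (x, p) = (2 * Real.pi * Complex.I)⁻¹ • (∮ z in C(0, R), (z - p.1)⁻¹ • f (x, (z, p.2))) := by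
      rw [hC, smul_smul, inv_mul_cancel₀ (by simp [Real.pi_ne_zero]), one_smul]
    rw [this, circleIntegral, ← intervalIntegral.integral_smul]
    apply intervalIntegral.integral_congr
    intro θ hθ
    rw [Set.uIcc_of_le two_pi_nn] at hθ
    have e1 : (w * (Ring.inverse (aff p.1) * g' p.2)) (x, ⟨θ, hθ⟩) =
        ((2 * Real.pi * Complex.I)⁻¹ * (circleMap 0 R θ * Complex.I)) *
        ((Ring.inverse (aff p.1)) (x, ⟨θ, hθ⟩) * (g' p.2) (x, ⟨θ, hθ⟩)) := rfl
    simp only [Set.projIcc_of_mem two_pi_nn hθ, deriv_circleMap, smul_eq_mul]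
    rw [e1, hinv, hp2]
    ring

lemma osg_fin : ∀ (k : ℕ) (E : Type) [NormedAddCommGroup E] [NormedSpace ℂ E] [FiniteDimensional ℂ E],
    Module.finrank ℂ E = k → OsgoodP E := by
  intro k
  induction k with
  | zero =>
    intro E _ _ _ hE
    have := Module.finrank_zero_iff.1 hE
    exact osg_zero E
  | succ k ih =>
    intro E _ _ _ hE
    have T : (ℂ × (Fin k → ℂ)) ≃L[ℂ] E := ContinuousLinearEquiv.ofFinrankEq (by simp [hE]; omega)
    exact osg_equiv T (osg_succ (ih (Fin k → ℂ) (by simp)))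

/-- Osgood: complex differentiability implies analyticity in finitely many variables. -/
lemma osgood {E : Type} [NormedAddCommGroup E] [NormedSpace ℂ E] [FiniteDimensional ℂ E]
    {f : E → ℂ} {B : Set E} (hB : IsOpen B) (hf : DifferentiableOn ℂ f B) : AnalyticOnNhd ℂ f B := by
  intro x hx
  obtain ⟨r, hr, hrB⟩ := Metric.isOpen_iff.1 hB x hx
  have hmap : ∀ e ∈ Metric.ball (0:E) r, x + e ∈ B := fun e he => hrB (by simpa using he)
  have hd : DifferentiableOn ℂ (fun e => f (x + e)) (Metric.ball 0 r) :=
    hf.comp (by fun_prop) hmap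
  obtain ⟨g, hg, hg'⟩ := osg_fin _ E rfl Unit (fun p => f (x + p.2)) r hr
    (ContinuousOn.comp (g := fun e => f (x + e)) (f := Prod.snd) (t := Metric.ball 0 r) hd.continuousOn continuousOn_snd fun p hp => hp.2) (fun _ => hd)
  have h1 : AnalyticAt ℂ (fun e => g e ()) 0 :=
    AnalyticAt.comp (g := ContinuousMap.evalCLM (M := ℂ) ℂ ()) ((ContinuousMap.evalCLM (M := ℂ) ℂ ()).analyticAt _) hg
  have h2 : AnalyticAt ℂ (fun e => f (x + e)) 0 := by
    refine h1.congr ?_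
    filter_upwards [hg'] with e he using he ()
  have h3 : AnalyticAt ℂ (fun y : E => y - x) x := analyticAt_id.sub analyticAt_const
  have h4 : AnalyticAt ℂ (fun e => f (x + e)) ((fun y : E => y - x) x) := by simpa using h2
  have := AnalyticAt.comp (f := fun y : E => y - x) (g := fun e => f (x + e)) h4 h3
  refine this.congr ?_
  filter_upwards with y
  simp

end PO1

section PE1

open Topology
open scoped ContDiff

noncomputable def jj : ℂ →L[ℝ] ℂ × ℂ :=
  (ContinuousLinearMap.id ℝ ℂ).prod (Complex.conjCLE : ℂ →L[ℝ] ℂ)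

lemma jj_apply (s : ℂ) : jj s = (s, (starRingEnd ℂ) s) := rfl

lemma polar_fderiv {v : ℂ → ℝ} {H : ℂ × ℂ → ℂ} {s0 : ℂ} (hH : DifferentiableAt ℂ H (jj s0))
    (hv : ∀ᶠ s in 𝓝 s0, (v s : ℂ) = H (jj s)) (u : ℂ) :
    ((fderiv ℝ v s0 u : ℝ) : ℂ) = fderiv ℂ H (jj s0) (jj u) := by
  have e1 : HasFDerivAt (fun s => H (jj s)) (((fderiv ℂ H (jj s0)).restrictScalars ℝ).comp jj) s0 :=
    (hH.hasFDerivAt.restrictScalars ℝ).comp s0 jj.hasFDerivAt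
  have e2 : HasFDerivAt (fun s => (v s : ℂ)) (((fderiv ℂ H (jj s0)).restrictScalars ℝ).comp jj) s0 :=
    e1.congr_of_eventuallyEq hv
  have e3 : HasFDerivAt v (Complex.reCLM.comp (((fderiv ℂ H (jj s0)).restrictScalars ℝ).comp jj)) s0 :=
    Complex.reCLM.hasFDerivAt.comp s0 e2
  have e4 : HasFDerivAt (fun s => (v s : ℂ)) (Complex.ofRealCLM.comp (fderiv ℝ v s0)) s0 :=
    Complex.ofRealCLM.hasFDerivAt.comp s0 e3.differentiableAt.hasFDerivAt
  exact DFunLike.congr_fun (e4.unique e2) u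

noncomputable def mx (H : ℂ × ℂ → ℂ) (p : ℂ × ℂ) : ℂ := fderiv ℂ (fderiv ℂ H) p (1, 0) (0, 1)

lemma fderiv_apply_eq {E : Type*} [NormedAddCommGroup E] [NormedSpace ℂ E] {H : E → ℂ} {p : E}
    (hH : AnalyticAt ℂ H p) (u v : E) :
    fderiv ℂ (fun p => fderiv ℂ H p u) p v = fderiv ℂ (fderiv ℂ H) p v u := by
  have h2 : HasFDerivAt (fderiv ℂ H) (fderiv ℂ (fderiv ℂ H) p) p :=
    hH.fderiv.differentiableAt.hasFDerivAt
  have h3 : HasFDerivAt (fun p => fderiv ℂ H p u)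
    ((ContinuousLinearMap.apply ℂ ℂ u).comp (fderiv ℂ (fderiv ℂ H) p)) p :=
    (ContinuousLinearMap.apply ℂ ℂ u).hasFDerivAt.comp p h2
  rw [h3.fderiv]
  rfl

lemma mx_analytic {H : ℂ × ℂ → ℂ} {B : Set (ℂ × ℂ)} (hH : AnalyticOnNhd ℂ H B) :
    AnalyticOnNhd ℂ (mx H) B := by
  intro p hp
  have h1 := (hH p hp).fderiv.fderiv
  have h2 := ((ContinuousLinearMap.apply ℂ (ℂ × ℂ →L[ℂ] ℂ) ((1, 0) : ℂ × ℂ)).analyticAt _).comp h1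
  exact ((ContinuousLinearMap.apply ℂ ℂ ((0, 1) : ℂ × ℂ)).analyticAt _).comp h2

lemma lap_eq_mx {v : ℂ → ℝ} {H : ℂ × ℂ → ℂ} {s0 : ℂ} (hH : AnalyticAt ℂ H (jj s0))
    (hv : ∀ᶠ s in 𝓝 s0, (v s : ℂ) = H (jj s)) :
    ((lap v s0 : ℝ) : ℂ) = 4 * mx H (jj s0) := by
  have hev : ∀ᶠ s in 𝓝 s0, AnalyticAt ℂ H (jj s) :=
    jj.continuous.continuousAt.eventually hH.eventually_analyticAt
  have key : ∀ u : ℂ, ((fderiv ℝ (fun t => fderiv ℝ v t u) s0 u : ℝ) : ℂ) =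
      fderiv ℂ (fderiv ℂ H) (jj s0) (jj u) (jj u) := by
    intro u
    rw [← fderiv_apply_eq hH]
    apply polar_fderiv
    · have h1 := hH.fderiv
      exact (((ContinuousLinearMap.apply ℂ ℂ (jj u)).analyticAt _).comp h1).differentiableAt
    · filter_upwards [hev, hv.eventually_nhds] with s hs hs'
      exact polar_fderiv hs.differentiableAt hs' u
  have hs : IsSymmSndFDerivAt ℂ H (jj s0) :=
    (hH.contDiffAt (n := ω)).isSymmSndFDerivAt (by simp)
  unfold lap mx
  push_cast
  rw [key, key]
  have j1 : jj 1 = (1:ℂ) • ((1, 0) : ℂ × ℂ) + (1:ℂ) • ((0, 1) : ℂ × ℂ) := by simp [jj_apply]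
  have j2 : jj Complex.I = Complex.I • ((1, 0) : ℂ × ℂ) + (-Complex.I) • ((0, 1) : ℂ × ℂ) := by
    simp [jj_apply]
  have hsy := hs.eq (0, 1) (1, 0)
  rw [j1, j2]
  simp only [map_add, map_smul, add_apply, smul_apply, smul_eq_mul, hsy]
  linear_combination ((fderiv ℂ (fderiv ℂ H) (jj s0) (1,0) (1,0)) - 2 * (fderiv ℂ (fderiv ℂ H) (jj s0) (1,0) (0,1)) + (fderiv ℂ (fderiv ℂ H) (jj s0) (0,1) (0,1))) * Complex.I_sq

lemma lap_const_mul (μ : ℝ) (v : ℂ → ℝ) (s : ℂ) : lap (fun t => μ * v t) s = μ * lap v s := by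
  have h : ∀ (w : ℂ → ℝ) (t u : ℂ), fderiv ℝ (fun t => μ * w t) t u = μ * fderiv ℝ w t u := by
    intro w t u
    have := congrFun (fderiv_const_smul_field (𝕜 := ℝ) (f := w) μ) t
    have h2 : (fun t => μ * w t) = μ • w := rfl
    rw [h2, this]
    rfl
  unfold lap
  simp only [h]
  ring

end PE1

section PE2

open Topology
open scoped ContDiff

lemma zero_of_real {r : ℝ} (hr : 0 < r) {q : ℂ → ℂ} (hq : DifferentiableOn ℂ q (Metric.ball 0 r))
    (h : ∀ x : ℝ, |x| < r → q x = 0) : ∀ z ∈ Metric.ball (0:ℂ) r, q z = 0 := by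
  have ha : AnalyticOnNhd ℂ q (Metric.ball 0 r) := hq.analyticOnNhd Metric.isOpen_ball
  refine ha.eqOn_zero_of_preconnected_of_frequently_eq_zero (convex_ball _ _).isPreconnected
    (Metric.mem_ball_self hr) ?_
  have ht : Filter.Tendsto (fun x : ℝ => (x : ℂ)) (𝓝[≠] 0) (𝓝[≠] 0) := by
    refine tendsto_nhdsWithin_iff.2 ⟨?_, ?_⟩
    · exact (Complex.continuous_ofReal.tendsto' 0 0 (by simp)).mono_left nhdsWithin_le_nhds
    · filter_upwards [self_mem_nhdsWithin] with x hx
      simpa using hx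
  refine ht.frequently (Filter.Eventually.frequently ?_)
  filter_upwards [nhdsWithin_le_nhds (Metric.ball_mem_nhds (0:ℝ) hr)] with x hx
  exact h x (by simpa using hx)

lemma polar_zero {s0 : ℂ} {r : ℝ} (hr : 0 < r) {Q : ℂ × ℂ → ℂ}
    (hQ : AnalyticOnNhd ℂ Q (Metric.ball s0 r ×ˢ Metric.ball ((starRingEnd ℂ) s0) r))
    (h : ∀ s ∈ Metric.ball s0 r, Q (jj s) = 0) :
    ∀ s ∈ Metric.ball s0 (r/2), ∀ t ∈ Metric.ball ((starRingEnd ℂ) s0) (r/2), Q (s, t) = 0 := by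
  have hr2 : 0 < r / 2 := by linarith
  set A : ℂ → ℂ → ℂ × ℂ := fun x y => (s0 + x + Complex.I * y, (starRingEnd ℂ) s0 + x - Complex.I * y) with hA
  have hAm : ∀ x ∈ Metric.ball (0:ℂ) (r/2), ∀ y ∈ Metric.ball (0:ℂ) (r/2),
      A x y ∈ (Metric.ball s0 r ×ˢ Metric.ball ((starRingEnd ℂ) s0) r) := by
    intro x hx y hy
    simp only [Metric.mem_ball, dist_zero_right] at hx hy
    constructor
    · simp only [hA, Metric.mem_ball, dist_eq_norm]
      rw [show s0 + x + Complex.I * y - s0 = x + Complex.I * y by ring]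
      refine (norm_add_le _ _).trans_lt ?_
      simp; linarith
    · simp only [hA, Metric.mem_ball, dist_eq_norm]
      rw [show (starRingEnd ℂ) s0 + x - Complex.I * y - (starRingEnd ℂ) s0 = x - Complex.I * y by ring]
      refine (norm_sub_le _ _).trans_lt ?_
      simp; linarith
  have s1 : ∀ y : ℝ, |y| < r / 2 → ∀ x ∈ Metric.ball (0:ℂ) (r/2), Q (A x y) = 0 := by
    intro y hy
    have hyb : (y:ℂ) ∈ Metric.ball (0:ℂ) (r/2) := by simpa using hy
    refine zero_of_real hr2 (fun x hx => ?_) ?_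
    · apply DifferentiableAt.differentiableWithinAt
      refine DifferentiableAt.comp (f := fun x => A x y) x (hQ _ (hAm x hx y hyb)).differentiableAt ?_
      simp only [hA]; fun_prop
    · intro x hx
      have hxb : (x:ℂ) ∈ Metric.ball (0:ℂ) (r/2) := by simpa using hx
      have h1 : A x y = jj (s0 + x + Complex.I * y) := by
        simp [hA, jj_apply]; ring
      rw [h1]
      exact h _ (hAm _ hxb _ hyb).1
  have s2 : ∀ x ∈ Metric.ball (0:ℂ) (r/2), ∀ y ∈ Metric.ball (0:ℂ) (r/2), Q (A x y) = 0 := by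
    intro x hx
    refine zero_of_real hr2 (fun y hy => ?_) (fun y hy => s1 y hy x hx)
    apply DifferentiableAt.differentiableWithinAt
    refine DifferentiableAt.comp (f := fun y => A x y) y (hQ _ (hAm x hx y hy)).differentiableAt ?_
    simp only [hA]; fun_prop
  intro s hs t ht
  simp only [Metric.mem_ball, dist_eq_norm] at hs ht
  have := s2 (((s - s0) + (t - (starRingEnd ℂ) s0)) / 2) ?_
    (-Complex.I * ((s - s0) - (t - (starRingEnd ℂ) s0)) / 2) ?_
  · convert this using 2
    simp only [hA]
    ext
    · simp only
      linear_combination ((s - s0) - (t - (starRingEnd ℂ) s0)) / 2 * Complex.I_sq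
    · simp only
      linear_combination -((s - s0) - (t - (starRingEnd ℂ) s0)) / 2 * Complex.I_sq
  · simp only [Metric.mem_ball, dist_zero_right, norm_div]
    have := norm_add_le (s - s0) (t - (starRingEnd ℂ) s0)
    simp only [Complex.norm_ofNat]; linarith
  · simp only [Metric.mem_ball, dist_zero_right, norm_div, norm_mul, norm_neg, Complex.norm_I, one_mul]
    have := norm_sub_le (s - s0) (t - (starRingEnd ℂ) s0)
    simp only [Complex.norm_ofNat]; linarith

lemma mx_eq_of_hasDerivAt {H : ℂ × ℂ → ℂ} {s t d : ℂ} (hH : AnalyticAt ℂ H (s, t))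
    {q : ℂ → ℂ} (hq : ∀ᶠ x in 𝓝 s, HasDerivAt (fun t => H (x, t)) (q x) t)
    (hd : HasDerivAt q d s) : mx H (s, t) = d := by
  obtain ⟨d', -, h2, h3⟩ := mixed_symm (L := H) (γ := fun x => x) (K := fun x => x) (ε0 := s) (t0 := t)
    hH differentiableAt_id differentiableAt_id
  simp only [deriv_id''] at h2 h3
  unfold mx
  rw [← h3]
  refine h2.unique (hd.congr_of_eventuallyEq ?_)
  have hev : ∀ᶠ x in 𝓝 s, AnalyticAt ℂ H (x, t) :=
    (Continuous.prodMk_left t).continuousAt.eventually hH.eventually_analyticAt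
  filter_upwards [hq, hev] with x hx hxa
  have p1 : HasDerivAt (fun t => (x, t)) ((0 : ℂ), (1:ℂ)) t :=
    (hasDerivAt_const t x).prodMk (hasDerivAt_id t)
  exact (hxa.differentiableAt.hasFDerivAt.comp_hasDerivAt t p1).unique hx

lemma mx_sum {n : ℕ} {f h : Fin n → ℂ → ℂ} {s t : ℂ} (hf : ∀ j, AnalyticAt ℂ (f j) s)
    (hh : ∀ j, AnalyticAt ℂ (h j) t) :
    AnalyticAt ℂ (fun p : ℂ × ℂ => ∑ j, f j p.1 * h j p.2) (s, t) ∧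
    mx (fun p : ℂ × ℂ => ∑ j, f j p.1 * h j p.2) (s, t) = ∑ j, deriv (f j) s * deriv (h j) t := by
  have hH : AnalyticAt ℂ (fun p : ℂ × ℂ => ∑ j, f j p.1 * h j p.2) (s, t) := by
    apply Finset.analyticAt_fun_sum
    intro j _
    exact ((hf j).comp (x := (s, t)) analyticAt_fst).mul ((hh j).comp (x := (s, t)) analyticAt_snd)
  refine ⟨hH, mx_eq_of_hasDerivAt hH (q := fun s => ∑ j, f j s * deriv (h j) t) ?_ ?_⟩
  · refine Filter.Eventually.of_forall fun x => ?_
    exact HasDerivAt.fun_sum fun j _ => ((hh j).differentiableAt.hasDerivAt).const_mul (f j x)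
  · exact HasDerivAt.fun_sum fun j _ => ((hf j).differentiableAt.hasDerivAt).mul_const _

lemma mx_comp {E : Type*} [NormedAddCommGroup E] [NormedSpace ℂ E]
    {L : E × E → ℂ} {G K : ℂ → E} {s t : ℂ} (hL : AnalyticAt ℂ L (G s, K t))
    (hG : AnalyticAt ℂ G s) (hK : AnalyticAt ℂ K t) :
    AnalyticAt ℂ (fun p : ℂ × ℂ => L (G p.1, K p.2)) (s, t) ∧
    mx (fun p : ℂ × ℂ => L (G p.1, K p.2)) (s, t) =
      fderiv ℂ (fderiv ℂ L) (G s, K t) (deriv G s, 0) (0, deriv K t) := by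
  have hGK : AnalyticAt ℂ (fun p : ℂ × ℂ => (G p.1, K p.2)) (s, t) :=
    (hG.comp (x := (s, t)) analyticAt_fst).prod (hK.comp (x := (s, t)) analyticAt_snd)
  have hH : AnalyticAt ℂ (fun p : ℂ × ℂ => L (G p.1, K p.2)) (s, t) :=
    AnalyticAt.fun_comp (f := fun p : ℂ × ℂ => (G p.1, K p.2)) hL hGK
  obtain ⟨d, -, h2, h3⟩ := mixed_symm hL hG.differentiableAt hK.differentiableAt
  refine ⟨hH, mx_eq_of_hasDerivAt hH (q := fun s => fderiv ℂ L (G s, K t) (0, deriv K t)) ?_ (h3 ▸ h2)⟩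
  have hc : ContinuousAt (fun x => (G x, K t)) s := hG.continuousAt.prodMk continuousAt_const
  filter_upwards [hc.eventually hL.eventually_analyticAt] with x hx
  have p1 : HasDerivAt (fun t => (G x, K t)) ((0 : E), deriv K t) t :=
    (hasDerivAt_const t (G x)).prodMk hK.differentiableAt.hasDerivAt
  exact hx.differentiableAt.hasFDerivAt.comp_hasDerivAt t p1

end PE2

section PE3

open Topology
open scoped ContDiff

lemma nash_of_pair {m : ℕ} {W : Set ((Fin m → ℂ) × (Fin m → ℂ))} (hW : IsOpen W)
    {Φ : (Fin m → ℂ) × (Fin m → ℂ) → ℂ} (h : IsNashOnPair m W Φ) {p : (Fin m → ℂ) × (Fin m → ℂ)}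
    (hp : p ∈ W) : ∃ r > 0, Metric.ball p r ⊆ W ∧ NashOn (cpp m) (Metric.ball p r) Φ := by
  obtain ⟨hd, hN⟩ := h
  obtain ⟨U, hU, hpU, hUW, P, hP, hP0⟩ := hN p hp
  obtain ⟨r, hr, hrU⟩ := Metric.isOpen_iff.1 hU p hpU
  refine ⟨r, hr, hrU.trans hUW, ?_, MvPolynomial.optionEquivLeft ℂ (Fin m ⊕ Fin m) P, ?_, ?_⟩
  · exact osgood Metric.isOpen_ball (hd.mono (hrU.trans hUW))
  · exact (map_ne_zero_iff _ (MvPolynomial.optionEquivLeft ℂ (Fin m ⊕ Fin m)).injective).2 hP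
  · intro x hx
    rw [← hP0 x (hrU hx)]
    have : ((Polynomial.evalRingHom (Φ x)).comp (Polynomial.mapRingHom
        (MvPolynomial.eval (fun i => cpp m i x)))).comp
        (MvPolynomial.optionEquivLeft ℂ (Fin m ⊕ Fin m)).toRingEquiv.toRingHom =
        MvPolynomial.eval (fun o : Option (Fin m ⊕ Fin m) => o.elim (Φ x) (Sum.elim x.1 x.2)) := by
      apply MvPolynomial.ringHom_ext
      · intro r; simp
      · rintro (_ | (i | i)) <;> simp [MvPolynomial.optionEquivLeft_X_none, cpp]
    exact DFunLike.congr_fun this P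

lemma nash_detG {m : ℕ} {B : Set ((Fin m → ℂ) × (Fin m → ℂ))} (hBo : IsOpen B)
    (hB : IsPreconnected B) {Φ : (Fin m → ℂ) × (Fin m → ℂ) → ℂ} (h : NashOn (cpp m) B Φ)
    (h0 : ∀ p ∈ B, Φ p ≠ 0) : NashOn (cpp m) B (detG m Φ) := by
  have hg : ∀ i j, NashOn (cpp m) B (gMat m Φ i j) := by
    intro i j
    have e1 := nash_fderiv (cpp_surj m) hBo hB h (0, Pi.single j 1)
    have e2 := nash_fderiv (cpp_surj m) hBo hB h (Pi.single i 1, 0)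
    have e3 := nash_fderiv (cpp_surj m) hBo hB e1 (Pi.single i 1, 0)
    have e4 := ((h.inv h0).mul e3).sub ((((h.inv h0).mul (h.inv h0)).mul e2).mul e1)
    refine e4.congr hBo fun p hp => ?_
    simp only [gMat, pderivZ, pderivW, sq, mul_inv]
    rfl
  have := NashOn.sum (c := cpp m) (B := B) (Finset.univ : Finset (Equiv.Perm (Fin m)))
    (f := fun σ p => (((Equiv.Perm.sign σ : ℤˣ) : ℤ) : ℂ) * ∏ i, gMat m Φ (σ i) i p)
    (fun σ _ => (NashOn.const _ _).mul (NashOn.prod _ fun i _ => hg _ _))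
  refine this.congr hBo fun p hp => ?_
  simp only [detG, Matrix.det_apply']
  rfl

end PE3

section PE4

open Topology
open scoped ComplexOrder

lemma local_zero {m n : ℕ} {U : Set (Fin m → ℂ)} (hUo : IsOpen U)
    {Φ : (Fin m → ℂ) × (Fin m → ℂ) → ℂ}
    (hΦNash : IsNashOnPair m (U ×ˢ {w : Fin m → ℂ | star w ∈ U}) Φ)
    (hΦne : ∀ p ∈ U ×ˢ {w : Fin m → ℂ | star w ∈ U}, Φ p ≠ 0)
    (hΦ : ∀ z ∈ U, ∃ x : ℝ, 0 < x ∧ Φ (z, star z) = x)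
    (hD : ∀ z ∈ U, ∃ x : ℝ, 0 < x ∧ detG m Φ (z, star z) = x)
    (α β μ : ℝ) {V : Set ℂ} (hVo : IsOpen V)
    {f : Fin n → ℂ → ℂ} (hf : ∀ j, DifferentiableOn ℂ (f j) V)
    {G : ℂ → Fin m → ℂ} (hG : DifferentiableOn ℂ G V) (hGU : ∀ s ∈ V, G s ∈ U)
    (heq : ∀ s ∈ V,
      lap (fun t => ∑ j, Complex.normSq (f j t)) s =
        μ * lap (fun t =>
          -α * Real.log ((detG m Φ (G t, star (G t))).re) +
            β * Real.log ((Φ (G t, star (G t))).re)) s)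
    {s0 : ℂ} (hs0 : s0 ∈ V) {δ : ℝ} (hδ : 0 < δ) :
    ∃ s1 ∈ Metric.ball s0 δ, s1 ∈ V ∧ ∀ j, deriv (f j) s1 = 0 := by
  set z0 := G s0 with hz0
  have hz0U : z0 ∈ U := hGU s0 hs0
  set p0 : (Fin m → ℂ) × (Fin m → ℂ) := (z0, star z0) with hp0
  have hWo : IsOpen (U ×ˢ {w : Fin m → ℂ | star w ∈ U}) :=
    hUo.prod (hUo.preimage continuous_star)
  have hp0W : p0 ∈ U ×ˢ {w : Fin m → ℂ | star w ∈ U} := ⟨hz0U, by simpa [hp0] using hz0U⟩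
  obtain ⟨r0, hr0, hr0W, hN0⟩ := nash_of_pair hWo hΦNash hp0W
  have hND0 := nash_detG Metric.isOpen_ball (convex_ball _ _).isPreconnected hN0
    (fun p hp => hΦne p (hr0W hp))
  have slit : ∀ x : ℝ, 0 < x → (x : ℂ) ∈ Complex.slitPlane := fun x hx => by simp [hx]
  have hΦs : ∀ᶠ p in 𝓝 p0, Φ p ∈ Complex.slitPlane := by
    apply (hN0.1 p0 (Metric.mem_ball_self hr0)).continuousAt.eventually
    apply Complex.isOpen_slitPlane.mem_nhds
    obtain ⟨x, hx, hx'⟩ := hΦ z0 hz0U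
    rw [hx']; exact slit x hx
  have hDs : ∀ᶠ p in 𝓝 p0, detG m Φ p ∈ Complex.slitPlane := by
    apply (hND0.1 p0 (Metric.mem_ball_self hr0)).continuousAt.eventually
    apply Complex.isOpen_slitPlane.mem_nhds
    obtain ⟨x, hx, hx'⟩ := hD z0 hz0U
    rw [hx']; exact slit x hx
  obtain ⟨r1, hr1, hr1s⟩ := Metric.mem_nhds_iff.1 (hΦs.and hDs)
  set r := min r0 r1 with hr
  have hrpos : 0 < r := lt_min hr0 hr1
  have hsub0 : Metric.ball z0 r ×ˢ Metric.ball (star z0) r ⊆ Metric.ball p0 r0 := by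
    rw [ball_prod_same]; exact Metric.ball_subset_ball (min_le_left _ _)
  have hsub1 : Metric.ball z0 r ×ˢ Metric.ball (star z0) r ⊆ Metric.ball p0 r1 := by
    rw [ball_prod_same]; exact Metric.ball_subset_ball (min_le_right _ _)
  have hN := hN0.mono hsub0
  have hND := hND0.mono hsub0
  have hΦs' : ∀ p ∈ Metric.ball z0 r ×ˢ Metric.ball (star z0) r, Φ p ∈ Complex.slitPlane :=
    fun p hp => (hr1s (hsub1 hp)).1
  have hDs' : ∀ p ∈ Metric.ball z0 r ×ˢ Metric.ball (star z0) r, detG m Φ p ∈ Complex.slitPlane :=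
    fun p hp => (hr1s (hsub1 hp)).2
  -- the logarithm
  set L : (Fin m → ℂ) × (Fin m → ℂ) → ℂ := fun p =>
    ((-(μ * α) : ℝ) : ℂ) * Complex.log (detG m Φ p) + ((μ * β : ℝ) : ℂ) * Complex.log (Φ p) with hLdef
  have hLan : AnalyticOnNhd ℂ L (Metric.ball z0 r ×ˢ Metric.ball (star z0) r) := fun p hp =>
    (analyticAt_const.mul ((hND.1 p hp).clog (hDs' p hp))).add
      (analyticAt_const.mul ((hN.1 p hp).clog (hΦs' p hp)))
  have hL' : ∀ p ∈ Metric.ball z0 r ×ˢ Metric.ball (star z0) r, ∀ v, fderiv ℂ L p v =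
      ((-(μ * α) : ℝ) : ℂ) * (fderiv ℂ (detG m Φ) p v / detG m Φ p) +
      ((μ * β : ℝ) : ℂ) * (fderiv ℂ Φ p v / Φ p) := by
    intro p hp v
    have h1 := ((hND.1 p hp).differentiableAt.hasFDerivAt.clog (hDs' p hp)).const_mul ((-(μ * α) : ℝ) : ℂ)
    have h2 := ((hN.1 p hp).differentiableAt.hasFDerivAt.clog (hΦs' p hp)).const_mul ((μ * β : ℝ) : ℂ)
    have h3 : HasFDerivAt L _ p := h1.add h2
    rw [h3.fderiv]
    simp [div_eq_inv_mul]
  -- the small disc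
  have hGc : ContinuousAt G s0 := (hG.differentiableAt (hVo.mem_nhds hs0)).continuousAt
  obtain ⟨ρ, hρ, hρs⟩ := Metric.mem_nhds_iff.1 (Filter.inter_mem (hVo.mem_nhds hs0)
    (Filter.inter_mem (Metric.ball_mem_nhds s0 hδ) (hGc.preimage_mem_nhds (Metric.ball_mem_nhds z0 hrpos))))
  have hρV : ∀ s ∈ Metric.ball s0 ρ, s ∈ V := fun s hs => (hρs hs).1
  have hρG : ∀ s ∈ Metric.ball s0 ρ, G s ∈ Metric.ball z0 r := fun s hs => (hρs hs).2.2
  have hconj : ∀ t ∈ Metric.ball ((starRingEnd ℂ) s0) ρ, (starRingEnd ℂ) t ∈ Metric.ball s0 ρ := by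
    intro t ht
    rw [Metric.mem_ball] at ht ⊢
    rwa [← Complex.dist_conj_conj, Complex.conj_conj]
  have hconj' : ∀ s ∈ Metric.ball s0 ρ, (starRingEnd ℂ) s ∈ Metric.ball ((starRingEnd ℂ) s0) ρ := by
    intro t ht
    rw [Metric.mem_ball] at ht ⊢
    rwa [Complex.dist_conj_conj]
  set K : ℂ → Fin m → ℂ := star ∘ G ∘ (starRingEnd ℂ) with hKdef
  set h : Fin n → ℂ → ℂ := fun j => (starRingEnd ℂ) ∘ f j ∘ (starRingEnd ℂ) with hhdef
  have hKd : DifferentiableOn ℂ K (Metric.ball ((starRingEnd ℂ) s0) ρ) := by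
    intro t ht
    apply DifferentiableAt.differentiableWithinAt
    rw [hKdef, differentiableAt_star_conj_iff]
    exact hG.differentiableAt (hVo.mem_nhds (hρV _ (hconj t ht)))
  have hhd : ∀ j, DifferentiableOn ℂ (h j) (Metric.ball ((starRingEnd ℂ) s0) ρ) := by
    intro j t ht
    apply DifferentiableAt.differentiableWithinAt
    have := (hf j).differentiableAt (hVo.mem_nhds (hρV _ (hconj t ht)))
    have h2 := this.conj_conj
    rwa [Complex.conj_conj] at h2
  have hKO : ∀ t ∈ Metric.ball ((starRingEnd ℂ) s0) ρ, K t ∈ Metric.ball (star z0) r := by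
    intro t ht
    have := hρG _ (hconj t ht)
    rw [Metric.mem_ball] at this ⊢
    rw [hKdef]
    simp only [Function.comp_apply]
    rwa [dist_star_star]
  have hGd : DifferentiableOn ℂ G (Metric.ball s0 ρ) := hG.mono hρV
  have hfd : ∀ j, DifferentiableOn ℂ (f j) (Metric.ball s0 ρ) := fun j => (hf j).mono hρV
  have hGa := hGd.analyticOnNhd Metric.isOpen_ball
  have hKa := hKd.analyticOnNhd Metric.isOpen_ball
  have hfa := fun j => (hfd j).analyticOnNhd Metric.isOpen_ball
  have hha := fun j => (hhd j).analyticOnNhd Metric.isOpen_ball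
  set H1 : ℂ × ℂ → ℂ := fun p => ∑ j, f j p.1 * h j p.2 with hH1
  set H2 : ℂ × ℂ → ℂ := fun p => L (G p.1, K p.2) with hH2
  have m1 : ∀ s ∈ Metric.ball s0 ρ, ∀ t ∈ Metric.ball ((starRingEnd ℂ) s0) ρ,
      AnalyticAt ℂ H1 (s, t) ∧ mx H1 (s, t) = ∑ j, deriv (f j) s * deriv (h j) t :=
    fun s hs t ht => mx_sum (fun j => hfa j s hs) (fun j => hha j t ht)
  have m2 : ∀ s ∈ Metric.ball s0 ρ, ∀ t ∈ Metric.ball ((starRingEnd ℂ) s0) ρ,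
      AnalyticAt ℂ H2 (s, t) ∧ mx H2 (s, t) =
        fderiv ℂ (fderiv ℂ L) (G s, K t) (deriv G s, 0) (0, deriv K t) :=
    fun s hs t ht => mx_comp (hLan _ ⟨hρG s hs, hKO t ht⟩) (hGa s hs) (hKa t ht)
  have hQ : AnalyticOnNhd ℂ (fun p => mx H1 p - mx H2 p)
      (Metric.ball s0 ρ ×ˢ Metric.ball ((starRingEnd ℂ) s0) ρ) := by
    intro p hp
    have a1 : AnalyticOnNhd ℂ H1 (Metric.ball s0 ρ ×ˢ Metric.ball ((starRingEnd ℂ) s0) ρ) :=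
      fun q hq => (m1 q.1 hq.1 q.2 hq.2).1
    have a2 : AnalyticOnNhd ℂ H2 (Metric.ball s0 ρ ×ˢ Metric.ball ((starRingEnd ℂ) s0) ρ) :=
      fun q hq => (m2 q.1 hq.1 q.2 hq.2).1
    exact (mx_analytic a1 p hp).sub (mx_analytic a2 p hp)
  have hdiag : ∀ s ∈ Metric.ball s0 ρ, (fun p => mx H1 p - mx H2 p) (jj s) = 0 := by
    intro s hs
    have hnb : ∀ᶠ t in 𝓝 s, t ∈ Metric.ball s0 ρ := Metric.isOpen_ball.mem_nhds hs
    have e1 := lap_eq_mx (v := fun t => ∑ j, Complex.normSq (f j t)) (H := H1) (s0 := s)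
      (m1 s hs _ (hconj' s hs)).1 (by
        filter_upwards with t
        simp [H1, jj_apply, h, Complex.mul_conj])
    have e2 := lap_eq_mx (v := fun t => μ * (-α * Real.log ((detG m Φ (G t, star (G t))).re) +
            β * Real.log ((Φ (G t, star (G t))).re))) (H := H2) (s0 := s)
      (m2 s hs _ (hconj' s hs)).1 (by
        filter_upwards [hnb] with t ht
        obtain ⟨x, hx, hx'⟩ := hΦ (G t) (hGU t (hρV t ht))
        obtain ⟨y, hy, hy'⟩ := hD (G t) (hGU t (hρV t ht))
        have : H2 (jj t) = L (G t, star (G t)) := by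
          simp [H2, jj_apply, K]
        rw [this, hLdef]
        simp only [hx', hy', Complex.ofReal_re]
        rw [← Complex.ofReal_log hx.le, ← Complex.ofReal_log hy.le]
        push_cast
        ring)
    rw [lap_const_mul, ← heq s (hρV s hs), e1] at e2
    have : mx H1 (jj s) = mx H2 (jj s) := mul_left_cancel₀ (by norm_num) e2
    simp [this]
  have hzero := polar_zero hρ hQ hdiag
  have hρ2 : 0 < ρ / 2 := by positivity
  have hb1 : Metric.ball s0 (ρ/2) ⊆ Metric.ball s0 ρ := Metric.ball_subset_ball (by linarith)
  have hb2 : Metric.ball ((starRingEnd ℂ) s0) (ρ/2) ⊆ Metric.ball ((starRingEnd ℂ) s0) ρ :=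
    Metric.ball_subset_ball (by linarith)
  obtain ⟨s1, hs1, hs1z⟩ := core (Δ := Metric.ball s0 (ρ/2))
    (Δ' := Metric.ball ((starRingEnd ℂ) s0) (ρ/2)) (O1 := Metric.ball z0 r)
    (O2 := Metric.ball (star z0) r) (D := detG m Φ) (Φ := Φ) (L := L) (G := G) (K := K) (f := f)
    (h := h)
    Metric.isOpen_ball (convex_ball _ _).isPreconnected ⟨_, Metric.mem_ball_self hρ2⟩
    Metric.isOpen_ball (convex_ball _ _).isPreconnected ⟨_, Metric.mem_ball_self hρ2⟩
    Metric.isOpen_ball (convex_ball _ _).isPreconnected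
    Metric.isOpen_ball (convex_ball _ _).isPreconnected hND hN
    (fun p hp => Complex.slitPlane_ne_zero (hDs' p hp))
    (fun p hp => Complex.slitPlane_ne_zero (hΦs' p hp))
    hLan _ _ hL' (hGa.mono hb1) (hKa.mono hb2)
    (fun s hs => hρG s (hb1 hs)) (fun t ht => hKO t (hb2 ht))
    (fun j => (hfd j).mono hb1) (fun j => (hhd j).mono hb2) (by
      intro s hs t ht
      rw [← (m1 s (hb1 hs) t (hb2 ht)).2, ← (m2 s (hb1 hs) t (hb2 ht)).2]
      exact sub_eq_zero.1 (hzero s hs t ht))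
  refine ⟨s1, (hρs (hb1 hs1)).2.1, hρV _ (hb1 hs1), ?_⟩
  have hc1 : (starRingEnd ℂ) s1 ∈ Metric.ball ((starRingEnd ℂ) s0) (ρ/2) := by
    rw [Metric.mem_ball] at hs1 ⊢
    rwa [Complex.dist_conj_conj]
  have hfin := hs1z _ hc1
  have hdh : ∀ j, deriv (h j) ((starRingEnd ℂ) s1) = (starRingEnd ℂ) (deriv (f j) s1) := fun j =>
    ((hfa j s1 (hb1 hs1)).differentiableAt.hasDerivAt.conj_conj).deriv
  simp only [hdh, Complex.mul_conj] at hfin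
  have hfin2 : ∑ j, Complex.normSq (deriv (f j) s1) = 0 := by exact_mod_cast hfin
  rw [Finset.sum_eq_zero_iff_of_nonneg (fun j _ => Complex.normSq_nonneg _)] at hfin2
  exact fun j => Complex.normSq_eq_zero.1 (hfin2 j (Finset.mem_univ _))

end PE4

/-- Lemma 3.3 of the paper, in local coordinates.  If the Kähler potential of the
base has a Nash-algebraic (exponential) polarization `Φ`, then no holomorphic
curve can pull back the Euclidean Kähler form of `ℂ^n` to `μ` times the pullback
of the form `α⬝Ric + β⬝ω` (a Laplacian identity in the one-dimensional
parameter `s`), unless `F` is constant. -/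
theorem constant_of_shared_potential_base (m : ℕ) (hm : 0 < m)
    (U : Set (Fin m → ℂ)) (hUo : IsOpen U) (hUc : IsConnected U)
    (Φ : (Fin m → ℂ) × (Fin m → ℂ) → ℂ)
    (hΦNash : IsNashOnPair m (U ×ˢ {w : Fin m → ℂ | star w ∈ U}) Φ)
    (hΦne : ∀ p ∈ U ×ˢ {w : Fin m → ℂ | star w ∈ U}, Φ p ≠ 0)
    (hΦreal : ∀ z ∈ U, (Φ (z, star z)).im = 0)
    (hΦpos : ∀ z ∈ U, 0 < (Φ (z, star z)).re)
    (hgpos : ∀ z ∈ U,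
      Matrix.PosDef (Matrix.of fun i j : Fin m => gMat m Φ i j (z, star z)))
    (α β : ℝ)
    (hαβpos : ∀ z ∈ U,
      Matrix.PosDef (Matrix.of fun i j : Fin m =>
        (α : ℂ) * ricMat m Φ i j (z, star z) + (β : ℂ) * gMat m Φ i j (z, star z)))
    (μ : ℝ) (hμ : 0 < μ)
    (n : ℕ) (hn : 0 < n)
    (V : Set ℂ) (hVo : IsOpen V) (hVc : IsConnected V)
    (f : Fin n → ℂ → ℂ) (hf : ∀ j, DifferentiableOn ℂ (f j) V)
    (G : ℂ → Fin m → ℂ) (hG : DifferentiableOn ℂ G V) (hGU : ∀ s ∈ V, G s ∈ U)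
    (heq : ∀ s ∈ V,
      lap (fun t => ∑ j, Complex.normSq (f j t)) s =
        μ * lap (fun t =>
          -α * Real.log ((detG m Φ (G t, star (G t))).re) +
            β * Real.log ((Φ (G t, star (G t))).re)) s) :
    ∀ s ∈ V, ∀ t ∈ V, ∀ j, f j s = f j t := by
  intro s hs t ht j
  refine const_of_hasDerivAt hVo hVc.isPreconnected (q := f j) ?_ hs ht
  intro s0 hs0
  have hd := (hf j).differentiableAt (hVo.mem_nhds hs0)
  suffices h0 : deriv (f j) s0 = 0 by
    rw [← h0]; exact hd.hasDerivAt
  have hc : ContinuousAt (deriv (f j)) s0 :=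
    (((hf j).analyticOnNhd hVo) s0 hs0).deriv.continuousAt
  by_contra hne
  have hev : ∀ᶠ x in nhds s0, deriv (f j) x ≠ 0 := hc.eventually_ne hne
  obtain ⟨δ, hδ, hδs⟩ := Metric.mem_nhds_iff.1 hev
  obtain ⟨s1, h1, -, h3⟩ := local_zero hUo hΦNash hΦne
    (fun z hz => ⟨(Φ (z, star z)).re, hΦpos z hz, by
      apply Complex.ext <;> simp [hΦreal z hz]⟩)
    (fun z hz => by
      have hp : 0 < detG m Φ (z, star z) := (hgpos z hz).det_pos
      rw [Complex.lt_def] at hp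
      refine ⟨(detG m Φ (z, star z)).re, hp.1, ?_⟩
      apply Complex.ext
      · simp
      · simpa using hp.2.symm)
    α β μ hVo hf hG hGU heq hs0 hδ
  exact hδs h1 (h3 j)
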